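/- arXiv:2301.06728 — 5 statements merged into one kernel-verified Lean document; each statement's English description precedes it below -/
import Mathlib

section
/- Let u be a regular linear functional on ℂ[z] whose monic OPS (P_n)_{n≥0} satisfies 𝒮_q(𝒟_q P_n) = k_n P_{n−1} for all n ≥ 0, for some constants k_n ∈ ℂ. Then there exists s ∈ {1, −1} such that u satisfies the four functional equations: (q^s − 1)·𝐃_q(𝐒_q u) = 2·(z·u); 2q^{3s/2}·𝐃_q(𝐃_q(U₂·u)) = −((2z² + q^s − 1)·u); 2q^s·𝐒_q(𝐒_q u) = (−2z² + 1 + q^s)·u; and 8q^{5s/2}·𝐒_q(𝐃_q(U₂·u)) = ((1 − q^s)·z·(−4z² + q^{2s} + 3))·u. -/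
open Polynomial

noncomputable section

/-- `q^{1/2}` as a complex number, for a real `q`. -/
def qh (q : ℝ) : ℂ := ((Real.sqrt q : ℝ) : ℂ)

/-- `α = (q^{1/2} + q^{-1/2})/2`. -/
def alp (q : ℝ) : ℂ := (qh q + (qh q)⁻¹) / 2

/-- `α_n = (q^{n/2} + q^{-n/2})/2` (so that `α_{-1} = α`). -/
def alpn (q : ℝ) (n : ℤ) : ℂ := ((qh q) ^ n + (qh q) ^ (-n)) / 2

/-- `γ_n = (q^{n/2} - q^{-n/2})/(q^{1/2} - q^{-1/2})` (so that `γ_{-1} = -1`). -/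
def gamn (q : ℝ) (n : ℤ) : ℂ := ((qh q) ^ n - (qh q) ^ (-n)) / (qh q - (qh q)⁻¹)

/-- `U₂(z) = (α² - 1)(z² - 1)` as a polynomial. -/
def U2 (q : ℝ) : ℂ[X] := Polynomial.C ((alp q) ^ 2 - 1) * (X ^ 2 - 1)

/-- Defining property of the Askey–Wilson operator `𝒟_q` on `ℂ[z]`:
for every `w ≠ 0` with `w² ≠ 1`,
`(𝒟_q p)((w+w⁻¹)/2) = [p((q^{1/2}w+q^{-1/2}w⁻¹)/2) − p((q^{-1/2}w+q^{1/2}w⁻¹)/2)]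
  / (((q^{1/2}−q^{-1/2})/2)(w−w⁻¹))`. -/
def IsAW (q : ℝ) (D : ℂ[X] → ℂ[X]) : Prop :=
  ∀ p : ℂ[X], ∀ w : ℂ, w ≠ 0 → w ^ 2 ≠ 1 →
    (D p).eval ((w + w⁻¹) / 2) =
      (p.eval ((qh q * w + (qh q)⁻¹ * w⁻¹) / 2) -
          p.eval (((qh q)⁻¹ * w + qh q * w⁻¹) / 2)) /
        (((qh q - (qh q)⁻¹) / 2) * (w - w⁻¹))

/-- Defining property of the averaging operator `𝒮_q` on `ℂ[z]`:
for every `w ≠ 0` with `w² ≠ 1`,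
`(𝒮_q p)((w+w⁻¹)/2) = (1/2)[p((q^{1/2}w+q^{-1/2}w⁻¹)/2) + p((q^{-1/2}w+q^{1/2}w⁻¹)/2)]`. -/
def IsAv (q : ℝ) (S : ℂ[X] → ℂ[X]) : Prop :=
  ∀ p : ℂ[X], ∀ w : ℂ, w ≠ 0 → w ^ 2 ≠ 1 →
    (S p).eval ((w + w⁻¹) / 2) =
      (p.eval ((qh q * w + (qh q)⁻¹ * w⁻¹) / 2) +
          p.eval (((qh q)⁻¹ * w + qh q * w⁻¹) / 2)) / 2

/-- A monic orthogonal polynomial sequence with recurrence coefficients `(B_n, C_n)`: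
monic polynomials, `deg P_n = n`, `P_0 = 1` and the three-term recurrence
`P_{n+1} = (z - B_n) P_n - C_n P_{n-1}` (with `P_{-1} = 0`), `C_n ≠ 0` for `n ≥ 1`. -/
structure MonicOPS (P : ℕ → ℂ[X]) (B Co : ℕ → ℂ) : Prop where
  monic : ∀ n, (P n).Monic
  deg : ∀ n, (P n).natDegree = n
  p0 : P 0 = 1
  p1 : P 1 = X - Polynomial.C (B 0)
  ttrr : ∀ n : ℕ,
    P (n + 2) = (X - Polynomial.C (B (n + 1))) * P (n + 1) - Polynomial.C (Co (n + 1)) * P n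
  Cne : ∀ n : ℕ, 1 ≤ n → Co n ≠ 0

/-- The Appell-type property `𝒮_q(𝒟_q P_n) = k_n P_{n-1}` for all `n ≥ 0` (with `P_{-1} = 0`). -/
def AppellSD (Sq Dq : ℂ[X] → ℂ[X]) (P : ℕ → ℂ[X]) (k : ℕ → ℂ) : Prop :=
  Sq (Dq (P 0)) = 0 ∧ ∀ n : ℕ, Sq (Dq (P (n + 1))) = Polynomial.C (k (n + 1)) * P n

/-- The Appell-type property `𝒟_q(𝒮_q P_n) = k_n P_{n-1}` for all `n ≥ 0` (with `P_{-1} = 0`). -/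
def AppellDS (Dq Sq : ℂ[X] → ℂ[X]) (P : ℕ → ℂ[X]) (k : ℕ → ℂ) : Prop :=
  Dq (Sq (P 0)) = 0 ∧ ∀ n : ℕ, Dq (Sq (P (n + 1))) = Polynomial.C (k (n + 1)) * P n

end

open Polynomial

namespace AWaux

/-- Polynomials agreeing on all Joukowski points are equal. -/
lemma poly_ext (p g : ℂ[X])
    (h : ∀ w : ℂ, w ≠ 0 → w ^ 2 ≠ 1 → p.eval ((w + w⁻¹) / 2) = g.eval ((w + w⁻¹) / 2)) :
    p = g := by
  apply Polynomial.eq_of_infinite_eval_eq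
  have hsub : ({1, -1} : Set ℂ)ᶜ ⊆ {x | p.eval x = g.eval x} := by
    intro z hz
    simp only [Set.mem_compl_iff, Set.mem_insert_iff, Set.mem_singleton_iff, not_or] at hz
    obtain ⟨t, ht⟩ := IsAlgClosed.exists_pow_nat_eq (z ^ 2 - 1) (n := 2) (by norm_num)
    have h1 : (z + t) * (z - t) = 1 := by linear_combination -ht
    have hw0 : z + t ≠ 0 := left_ne_zero_of_mul_eq_one h1
    have hinv : (z + t)⁻¹ = z - t := inv_eq_of_mul_eq_one_right h1
    have hz' : ((z + t) + (z + t)⁻¹) / 2 = z := by rw [hinv]; ring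
    have hw2 : (z + t) ^ 2 ≠ 1 := by
      intro hc
      have : t = 0 := by
        have h3 : (z + t) * (2 * t) = 0 := by linear_combination hc - h1
        rcases mul_eq_zero.mp h3 with h4 | h4
        · exact absurd h4 hw0
        · simpa using h4
      subst this
      have h5 : (z - 1) * (z + 1) = 0 := by linear_combination h1
      rcases mul_eq_zero.mp h5 with h6 | h6
      · exact hz.1 (by linear_combination h6)
      · exact hz.2 (by linear_combination h6)
    have := h _ hw0 hw2
    rw [hz'] at this
    exact this
  exact Set.Infinite.mono hsub (Set.Finite.infinite_compl (by simp))

/-- The algebraic rules satisfied by the pair of operators. -/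
structure Rules (a : ℂ) (D S : ℂ[X] → ℂ[X]) : Prop where
  Dadd : ∀ p g, D (p + g) = D p + D g
  Sadd : ∀ p g, S (p + g) = S p + S g
  DC : ∀ c p, D (C c * p) = C c * D p
  SC : ∀ c p, S (C c * p) = C c * S p
  D1 : D 1 = 0
  S1 : S 1 = 1
  DX : ∀ p, D (X * p) = S p + C a * X * D p
  SX : ∀ p, S (X * p) = C (a ^ 2 - 1) * (X ^ 2 - 1) * D p + C a * X * S p

lemma sub_inv_ne {w : ℂ} (h0 : w ≠ 0) (h1 : w ^ 2 ≠ 1) : w - w⁻¹ ≠ 0 := by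
  intro h
  apply h1
  field_simp at h
  linear_combination h

lemma rules_of (q : ℝ) (hr0 : qh q ≠ 0) (hr1 : (qh q) ^ 2 ≠ 1)
    (D S : ℂ[X] → ℂ[X]) (hD : IsAW q D) (hS : IsAv q S) : Rules (alp q) D S := by
  have hrr := sub_inv_ne hr0 hr1
  constructor
  · intro p g; apply poly_ext; intro w h0 h1
    simp only [eval_add, hD _ w h0 h1]; ring
  · intro p g; apply poly_ext; intro w h0 h1
    simp only [eval_add, hS _ w h0 h1]; ring
  · intro p g; apply poly_ext; intro w h0 h1
    simp only [eval_mul, eval_C, hD _ w h0 h1]; ring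
  · intro p g; apply poly_ext; intro w h0 h1
    simp only [eval_mul, eval_C, hS _ w h0 h1]; ring
  · apply poly_ext; intro w h0 h1
    simp [hD _ w h0 h1]
  · apply poly_ext; intro w h0 h1
    simp [hS _ w h0 h1]
  · intro p; apply poly_ext; intro w h0 h1
    have hww := sub_inv_ne h0 h1
    simp only [eval_add, eval_mul, eval_C, eval_X, hD _ w h0 h1, hS _ w h0 h1, alp]
    rw [div_eq_iff (mul_ne_zero (div_ne_zero hrr two_ne_zero) hww)]
    generalize eval _ p = x
    generalize eval _ p = y
    generalize w⁻¹ = v at *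
    generalize (qh q)⁻¹ = t at *
    generalize qh q = r at *
    field_simp
    ring
  · intro p; apply poly_ext; intro w h0 h1
    have hww := sub_inv_ne h0 h1
    have e1 : w * w⁻¹ = 1 := mul_inv_cancel₀ h0
    have e2 : qh q * (qh q)⁻¹ = 1 := mul_inv_cancel₀ hr0
    simp only [eval_add, eval_sub, eval_mul, eval_pow, eval_one, eval_C, eval_X, hD _ w h0 h1, hS _ w h0 h1, alp]
    generalize eval _ p = x
    generalize eval _ p = y
    generalize w⁻¹ = v at *
    generalize (qh q)⁻¹ = t at *
    generalize qh q = r at *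
    have e3 : ((r + t) / 2) ^ 2 - 1 = ((r - t) / 2) ^ 2 := by linear_combination e2
    have e4 : ((w + v) / 2) ^ 2 - 1 = ((w - v) / 2) ^ 2 := by linear_combination e1
    rw [e3, e4]
    field_simp
    ring


section rules
variable {a : ℂ} {D S : ℂ[X] → ℂ[X]}

lemma Rules.Dsub (R : Rules a D S) (p g : ℂ[X]) : D (p - g) = D p - D g := by
  have h : p - g = p + C (-1) * g := by simp [sub_eq_add_neg]
  rw [h, R.Dadd, R.DC]; simp [sub_eq_add_neg]

lemma Rules.Ssub (R : Rules a D S) (p g : ℂ[X]) : S (p - g) = S p - S g := by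
  have h : p - g = p + C (-1) * g := by simp [sub_eq_add_neg]
  rw [h, R.Sadd, R.SC]; simp [sub_eq_add_neg]

/-- An induction principle: constants, sums, multiplication by `X`. -/
lemma poly_ind {M : ℂ[X] → Prop} (p : ℂ[X]) (h1 : M 1) (hC : ∀ c p, M p → M (C c * p))
    (hadd : ∀ p g, M p → M g → M (p + g)) (hX : ∀ p, M p → M (X * p)) : M p := by
  induction p using Polynomial.induction_on with
  | C c => simpa using hC c 1 h1
  | add p g hp hg => exact hadd p g hp hg
  | monomial n c h =>
    have : (C c * X ^ (n + 1) : ℂ[X]) = X * (C c * X ^ n) := by ring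
    rw [this]; exact hX _ h

lemma Rules.SDX (R : Rules a D S) (f : ℂ[X]) :
    S (D (X * f)) = S (S f) + C (a ^ 2) * X * S (D f)
      + C a * (C (a ^ 2 - 1) * (X ^ 2 - 1)) * D (D f) := by
  rw [R.DX, R.Sadd, mul_assoc, R.SC, R.SX]
  simp only [C_sub, C_pow, C_1]; ring

lemma Rules.comm (R : Rules a D S) (f : ℂ[X]) :
    D (S f) = C a * S (D f) + C (a ^ 2 - 1) * X * D (D f) ∧
    S (S f) = f + C (a ^ 2 - 1) * X * S (D f)
      + C a * (C (a ^ 2 - 1) * (X ^ 2 - 1)) * D (D f) := by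
  have D0 : D 0 = 0 := by simpa using R.DC 0 0
  have S0 : S 0 = 0 := by simpa using R.SC 0 0
  induction f using poly_ind with
  | h1 => simp [R.D1, R.S1, D0, S0]
  | hC c p h =>
    obtain ⟨h1, h2⟩ := h
    simp only [R.DC, R.SC]
    exact ⟨by linear_combination C c * h1, by linear_combination C c * h2⟩
  | hadd p g h h' =>
    obtain ⟨h1, h2⟩ := h
    obtain ⟨h1', h2'⟩ := h'
    simp only [R.Dadd, R.Sadd]
    exact ⟨by linear_combination h1 + h1', by linear_combination h2 + h2'⟩
  | hX p h =>
    obtain ⟨h1, h2⟩ := h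
    have e : ∀ g : ℂ[X], C (a ^ 2 - 1) * (X ^ 2 - 1) * g
        = C (a ^ 2 - 1) * (X * (X * g) - g) := by intro g; ring
    have DU : ∀ g : ℂ[X], D (C (a ^ 2 - 1) * (X ^ 2 - 1) * g)
        = C (a ^ 2 - 1) * (D (X * (X * g)) - D g) := by
      intro g; rw [e, R.DC, R.Dsub]
    have SU : ∀ g : ℂ[X], S (C (a ^ 2 - 1) * (X ^ 2 - 1) * g)
        = C (a ^ 2 - 1) * (S (X * (X * g)) - S g) := by
      intro g; rw [e, R.SC, R.Ssub]
    have DCX : ∀ g : ℂ[X], D (C a * X * g) = C a * D (X * g) := by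
      intro g; rw [mul_assoc, R.DC]
    have SCX : ∀ g : ℂ[X], S (C a * X * g) = C a * S (X * g) := by
      intro g; rw [mul_assoc, R.SC]
    simp only [R.DX, R.SX, R.Dadd, R.Sadd, DU, SU, DCX, SCX]
    rw [h2]
    rw [h1]
    simp only [C_sub, C_pow, C_1] at *
    constructor <;> ring

lemma Rules.DDX (R : Rules a D S) (f : ℂ[X]) :
    D (D (X * f)) = C (2 * a) * S (D f) + C (2 * a ^ 2 - 1) * X * D (D f) := by
  rw [R.DX, R.Dadd, mul_assoc, R.DC, R.DX, (R.comm f).1]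
  simp only [C_sub, C_pow, C_1, C_mul, C_ofNat]; ring

end rules

section ops
variable {u : ℂ[X] →ₗ[ℂ] ℂ} {P : ℕ → ℂ[X]}

lemma uC (u : ℂ[X] →ₗ[ℂ] ℂ) (c : ℂ) (p : ℂ[X]) : u (C c * p) = c * u p := by
  rw [← smul_eq_C_mul, map_smul, smul_eq_mul]

/-- The sequence as a Mathlib polynomial sequence. -/
noncomputable def seqOf (P : ℕ → ℂ[X]) (hmonic : ∀ n, (P n).Monic)
    (hdeg : ∀ n, (P n).natDegree = n) : Polynomial.Sequence ℂ :=
  ⟨P, fun n => by rw [Polynomial.degree_eq_natDegree (hmonic n).ne_zero, hdeg]⟩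

lemma functional_ext (hmonic : ∀ n, (P n).Monic) (hdeg : ∀ n, (P n).natDegree = n)
    (L M : ℂ[X] →ₗ[ℂ] ℂ) (h : ∀ n, L (P n) = M (P n)) : L = M := by
  apply LinearMap.ext_on (Polynomial.Sequence.span (seqOf P hmonic hdeg) _)
  · rintro _ ⟨n, rfl⟩; exact h n
  · intro n
    have : (P n).leadingCoeff = 1 := hmonic n
    change IsUnit (P n).leadingCoeff
    rw [this]; exact isUnit_one

lemma lowdeg (hmonic : ∀ n, (P n).Monic) (hdeg : ∀ n, (P n).natDegree = n)
    (horth : ∀ m n : ℕ, m ≠ n → u (P m * P n) = 0) (m : ℕ) (f : ℂ[X])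
    (hf : f.degree < m) : u (P m * f) = 0 := by
  have hmem : f ∈ Polynomial.degreeLT ℂ m := Polynomial.mem_degreeLT.mpr hf
  rw [← Polynomial.Sequence.span_degreeLT (seqOf P hmonic hdeg)] at hmem
  · refine Submodule.span_induction (p := fun f _ => u (P m * f) = 0) ?_ ?_ ?_ ?_ hmem
    · rintro _ ⟨i, hi, rfl⟩
      exact horth m i (ne_of_gt hi)
    · simp
    · intro x y _ _ hx hy; rw [mul_add, map_add, hx, hy, add_zero]
    · intro c x _ hx; rw [mul_smul_comm, map_smul, hx, smul_zero]
  · intro n _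
    have : (P n).leadingCoeff = 1 := hmonic n
    change IsUnit (P n).leadingCoeff
    rw [this]; exact isUnit_one

lemma degP (hmonic : ∀ n, (P n).Monic) (hdeg : ∀ n, (P n).natDegree = n) (n : ℕ) :
    (P n).degree = n := by
  rw [Polynomial.degree_eq_natDegree (hmonic n).ne_zero, hdeg]

lemma sub_deg (f g : ℂ[X]) (n : ℕ) (hf : f.degree = n) (hg : g.degree = n)
    (h : f.leadingCoeff = g.leadingCoeff) : (f - g).degree < n := by
  have h0 : f ≠ 0 := by rintro rfl; simp at hf
  have := Polynomial.degree_sub_lt_left (hf.trans hg.symm) h0 h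
  rwa [hf] at this

lemma nondeg (hmonic : ∀ n, (P n).Monic) (hdeg : ∀ n, (P n).natDegree = n)
    (horth : ∀ m n : ℕ, m ≠ n → u (P m * P n) = 0)
    (hreg : ∀ n : ℕ, u (P n ^ 2) ≠ 0) (f : ℂ[X]) (h : ∀ j, u (P j * f) = 0) : f = 0 := by
  by_contra hf
  set n := f.natDegree with hn
  have hl : f.leadingCoeff ≠ 0 := by simpa using hf
  have h1 : (f - C f.leadingCoeff * P n).degree < n := by
    apply sub_deg
    · exact Polynomial.degree_eq_natDegree hf
    · rw [Polynomial.degree_C_mul hl, degP hmonic hdeg]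
    · rw [Polynomial.leadingCoeff_mul, (hmonic n).leadingCoeff]; simp
  have h2 := lowdeg hmonic hdeg horth n _ h1
  have h3 : P n * (f - C f.leadingCoeff * P n) = P n * f - C f.leadingCoeff * P n ^ 2 := by ring
  rw [h3, map_sub, uC, h, zero_sub, neg_eq_zero] at h2
  exact mul_ne_zero hl (hreg n) h2

/-- Three-term recurrence. -/
lemma ttrr (hmonic : ∀ n, (P n).Monic) (hdeg : ∀ n, (P n).natDegree = n)
    (horth : ∀ m n : ℕ, m ≠ n → u (P m * P n) = 0)
    (hreg : ∀ n : ℕ, u (P n ^ 2) ≠ 0) (n : ℕ) :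
    ∃ b c : ℂ, c ≠ 0 ∧ u (P (n + 1) ^ 2) = c * u (P n ^ 2) ∧
      P (n + 2) = (X - C b) * P (n + 1) - C c * P n := by
  have hdP := degP hmonic hdeg
  have hdX : ∀ m, (X * P m).degree = ((m + 1 : ℕ) : WithBot ℕ) := by
    intro m; rw [Polynomial.degree_mul, hdP, Polynomial.degree_X]; push_cast; ring
  have hlX : ∀ m, (X * P m).leadingCoeff = (P (m + 1)).leadingCoeff := by
    intro m; rw [Polynomial.leadingCoeff_mul, (hmonic m).leadingCoeff,
      (hmonic (m + 1)).leadingCoeff]; simp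
  refine ⟨u (X * P (n + 1) ^ 2) / u (P (n + 1) ^ 2), u (P (n + 1) ^ 2) / u (P n ^ 2),
    div_ne_zero (hreg _) (hreg _), (div_mul_cancel₀ _ (hreg _)).symm, ?_⟩
  rw [← sub_eq_zero]
  set b := u (X * P (n + 1) ^ 2) / u (P (n + 1) ^ 2) with hb
  set c := u (P (n + 1) ^ 2) / u (P n ^ 2) with hc
  have hb' : b * u (P (n + 1) ^ 2) = u (X * P (n + 1) ^ 2) := div_mul_cancel₀ _ (hreg _)
  have hc' : c * u (P n ^ 2) = u (P (n + 1) ^ 2) := div_mul_cancel₀ _ (hreg _)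
  apply nondeg hmonic hdeg horth hreg
  intro j
  have hexp : u (P j * (P (n + 2) - ((X - C b) * P (n + 1) - C c * P n)))
      = u (P j * P (n + 2)) - u (P (n + 1) * (X * P j)) + b * u (P j * P (n + 1))
        + c * u (P j * P n) := by
    rw [← uC, ← uC, ← map_sub, ← map_add, ← map_add]; congr 1; ring
  rcases lt_trichotomy j n with hj | hj | hj
  · rw [hexp, horth _ _ (by omega), horth _ _ (by omega), horth _ _ (by omega),
      lowdeg hmonic hdeg horth]
    · ring
    · rw [hdX]; exact Nat.cast_lt.mpr (by omega)
  · subst hj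
    rw [hexp, horth _ _ (by omega), horth _ _ (by omega), ← pow_two, hc']
    have h1 := lowdeg hmonic hdeg horth (j + 1) (X * P j - P (j + 1))
      (sub_deg _ _ _ (hdX j) (hdP _) (hlX j))
    rw [mul_sub, map_sub, ← pow_two] at h1
    linear_combination -h1
  · rcases Nat.lt_or_ge j (n + 2) with hj2 | hj2
    · have : j = n + 1 := by omega
      subst this
      rw [hexp, horth _ _ (by omega), horth (n + 1) n (by omega), ← pow_two, hb']
      have : P (n + 1) * (X * P (n + 1)) = X * P (n + 1) ^ 2 := by ring
      rw [this]; ring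
    · apply lowdeg hmonic hdeg horth
      have h1 : (X * P (n + 1) - P (n + 2)).degree < ((n + 2 : ℕ) : WithBot ℕ) :=
        sub_deg _ _ _ (hdX (n + 1)) (hdP _) (hlX (n + 1))
      have h2 : P (n + 2) - ((X - C b) * P (n + 1) - C c * P n)
        = -(X * P (n + 1) - P (n + 2)) + (C b * P (n + 1) + C c * P n) := by ring
      have h3 : ∀ (e : ℂ) (m : ℕ), (C e * P m).degree ≤ (m : WithBot ℕ) := by
        intro e m
        by_cases he : e = 0
        · simp [he]
        · rw [Polynomial.degree_C_mul he, hdP]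
      rw [h2]
      refine lt_of_lt_of_le (b := ((n + 2 : ℕ) : WithBot ℕ)) ?_ (by exact_mod_cast hj2)
      refine lt_of_le_of_lt (Polynomial.degree_add_le _ _) (max_lt ?_ ?_)
      · rwa [Polynomial.degree_neg]
      · refine lt_of_le_of_lt (Polynomial.degree_add_le _ _) (max_lt ?_ ?_)
        · exact lt_of_le_of_lt (h3 _ _) (Nat.cast_lt.mpr (by omega))
        · exact lt_of_le_of_lt (h3 _ _) (Nat.cast_lt.mpr (by omega))

/-- The key functional relation. -/
lemma key (hmonic : ∀ n, (P n).Monic) (hdeg : ∀ n, (P n).natDegree = n)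
    (horth : ∀ m n : ℕ, m ≠ n → u (P m * P n) = 0)
    {a : ℂ} {D S : ℂ[X] → ℂ[X]} (R : Rules a D S)
    (k : ℕ → ℂ) (hAp : AppellSD S D P k) (m : ℕ) (c : ℂ)
    (hc : u (P (m + 1) ^ 2) = c * u (P m ^ 2)) (f : ℂ[X]) :
    c * u (P m * S (D f)) = k (m + 1) * u (P (m + 1) * f) := by
  let L : ℂ[X] →ₗ[ℂ] ℂ :=
    { toFun := fun f => c * u (P m * S (D f))
      map_add' := by intro x y; rw [R.Dadd, R.Sadd, mul_add, map_add]; ring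
      map_smul' := by
        intro e x
        rw [smul_eq_C_mul, R.DC, R.SC, mul_left_comm, uC]
        simp only [RingHom.id_apply, smul_eq_mul]; ring }
  let M : ℂ[X] →ₗ[ℂ] ℂ :=
    { toFun := fun f => k (m + 1) * u (P (m + 1) * f)
      map_add' := by intro x y; rw [mul_add, map_add]; ring
      map_smul' := by
        intro e x
        rw [smul_eq_C_mul, mul_left_comm, uC]
        simp only [RingHom.id_apply, smul_eq_mul]; ring }
  have hLM : L = M := by
    apply functional_ext hmonic hdeg
    intro n
    change c * u (P m * S (D (P n))) = k (m + 1) * u (P (m + 1) * P n)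
    cases n with
    | zero => rw [hAp.1, horth _ _ (by omega)]; simp
    | succ j =>
      rw [hAp.2, mul_left_comm, uC]
      by_cases hj : m = j
      · subst hj
        rw [← pow_two, ← pow_two, hc]; ring
      · rw [horth _ _ hj, horth _ _ (by omega)]; simp
  exact congrArg (fun F : ℂ[X] →ₗ[ℂ] ℂ => F f) hLM

end ops

end AWaux

namespace AWaux

section scalars
variable {a : ℂ} {D S : ℂ[X] → ℂ[X]}

lemma quart_zero (e0 e1 e2 e3 e4 : ℂ)
    (h : (C e4 * X ^ 4 + C e3 * X ^ 3 + C e2 * X ^ 2 + C e1 * X + C e0 : ℂ[X]) = 0) :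
    e4 = 0 ∧ e3 = 0 ∧ e2 = 0 ∧ e1 = 0 ∧ e0 = 0 := by
  have hc : ∀ j, (C e4 * X ^ 4 + C e3 * X ^ 3 + C e2 * X ^ 2 + C e1 * X + C e0 : ℂ[X]).coeff j
      = 0 := by intro j; rw [h]; simp
  have h0 := hc 0
  have h1 := hc 1
  have h2 := hc 2
  have h3 := hc 3
  have h4 := hc 4
  simp [coeff_X, coeff_C, coeff_X_pow] at h0 h1 h2 h3 h4
  exact ⟨h4, h3, h2, h1, h0⟩

/-- Values of `S D` on monomials of degree at most five. -/
lemma Rules.mono (R : Rules a D S) (A : ℂ) (hA : a ^ 2 = A) :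
    S (D 1) = 0 ∧ S (D X) = 1 ∧ S (D (X ^ 2)) = C (2 * A) * X ∧
    S (D (X ^ 3)) = C (1 - 6 * A + 8 * A ^ 2) * X ^ 2 + C (4 * A - 4 * A ^ 2) ∧
    S (D (X ^ 4)) = C (12 * A - 40 * A ^ 2 + 32 * A ^ 3) * X ^ 3
      + C (-8 * A + 32 * A ^ 2 - 24 * A ^ 3) * X ∧
    S (D (X ^ 5)) = C (1 - 20 * A + 120 * A ^ 2 - 224 * A ^ 3 + 128 * A ^ 4) * X ^ 4
      + C (16 * A - 120 * A ^ 2 + 232 * A ^ 3 - 128 * A ^ 4) * X ^ 2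
      + C (16 * A ^ 2 - 32 * A ^ 3 + 16 * A ^ 4) := by
  subst hA
  have S0 : S 0 = 0 := by simpa using R.SC 0 0
  have D0 : D 0 = 0 := by simpa using R.DC 0 0
  have hSD : ∀ f : ℂ[X], S (D (X * f)) = f + C (2 * a ^ 2 - 1) * X * S (D f)
      + C (2 * a * (a ^ 2 - 1)) * (X ^ 2 - 1) * D (D f) := by
    intro f
    rw [R.SDX, (R.comm f).2]
    simp only [C_sub, C_pow, C_1, C_mul, C_ofNat]; ring
  have s0 : S (D 1) = 0 := by rw [R.D1, S0]
  have d0 : D (D 1) = 0 := by rw [R.D1, D0]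
  have p1 : (X : ℂ[X]) = X * 1 := by ring
  have p2 : (X ^ 2 : ℂ[X]) = X * X := by ring
  have p3 : (X ^ 3 : ℂ[X]) = X * X ^ 2 := by ring
  have p4 : (X ^ 4 : ℂ[X]) = X * X ^ 3 := by ring
  have p5 : (X ^ 5 : ℂ[X]) = X * X ^ 4 := by ring
  have s1 : S (D X) = 1 := by rw [p1, hSD, s0, d0]; simp
  have d1 : D (D X) = 0 := by rw [p1, R.DDX, s0, d0]; simp
  have s2 : S (D (X ^ 2)) = C (2 * a ^ 2) * X := by
    rw [p2, hSD, s1, d1]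
    simp only [C_sub, C_pow, C_1, C_mul, C_ofNat]; ring
  have d2 : D (D (X ^ 2)) = C (2 * a) := by
    rw [p2, R.DDX, s1, d1]
    simp only [C_sub, C_pow, C_1, C_mul, C_ofNat]; ring
  have s3 : S (D (X ^ 3)) = C (1 - 6 * a ^ 2 + 8 * (a ^ 2) ^ 2) * X ^ 2
      + C (4 * a ^ 2 - 4 * (a ^ 2) ^ 2) := by
    rw [p3, hSD, s2, d2]
    simp only [C_sub, C_add, C_pow, C_1, C_mul, C_ofNat]; ring
  have d3 : D (D (X ^ 3)) = C (8 * a ^ 3 - 2 * a) * X := by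
    rw [p3, R.DDX, s2, d2]
    simp only [C_sub, C_pow, C_1, C_mul, C_ofNat]; ring
  have s4 : S (D (X ^ 4)) = C (12 * a ^ 2 - 40 * (a ^ 2) ^ 2 + 32 * (a ^ 2) ^ 3) * X ^ 3
      + C (-8 * a ^ 2 + 32 * (a ^ 2) ^ 2 - 24 * (a ^ 2) ^ 3) * X := by
    rw [p4, hSD, s3, d3]
    simp only [C_sub, C_add, C_neg, C_pow, C_1, C_mul, C_ofNat]; ring
  refine ⟨s0, s1, s2, s3, s4, ?_⟩
  rw [p5, hSD, s4, p4, R.DDX, s3, d3]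
  simp only [C_sub, C_add, C_neg, C_pow, C_1, C_mul, C_ofNat]; ring

/-- Coefficient comparison in degree five. -/
lemma Rules.five (R : Rules a D S) (A : ℂ) (hA : a ^ 2 = A)
    (p5 p4 p3 p2 p1 p0 r4 r3 r2 r1 r0 k : ℂ) (Pn Pm : ℂ[X])
    (hPn : Pn = C p5 * X ^ 5 + C p4 * X ^ 4 + C p3 * X ^ 3 + C p2 * X ^ 2 + C p1 * X + C p0 * 1)
    (hPm : Pm = C r4 * X ^ 4 + C r3 * X ^ 3 + C r2 * X ^ 2 + C r1 * X + C r0)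
    (h : S (D Pn) = C k * Pm) :
    (1 - 20 * A + 120 * A ^ 2 - 224 * A ^ 3 + 128 * A ^ 4) * p5 = k * r4 ∧
    (12 * A - 40 * A ^ 2 + 32 * A ^ 3) * p4 = k * r3 ∧
    (1 - 6 * A + 8 * A ^ 2) * p3 + (16 * A - 120 * A ^ 2 + 232 * A ^ 3 - 128 * A ^ 4) * p5
      = k * r2 ∧
    2 * A * p2 + (-8 * A + 32 * A ^ 2 - 24 * A ^ 3) * p4 = k * r1 ∧
    p1 + (4 * A - 4 * A ^ 2) * p3 + (16 * A ^ 2 - 32 * A ^ 3 + 16 * A ^ 4) * p5 = k * r0 := by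
  obtain ⟨s0, s1, s2, s3, s4, s5⟩ := R.mono A hA
  rw [hPn, hPm] at h
  simp only [R.Dadd, R.Sadd, R.DC, R.SC, s0, s1, s2, s3, s4, s5] at h
  obtain ⟨e4, e3, e2, e1, e0⟩ := quart_zero
    (p1 + (4 * A - 4 * A ^ 2) * p3 + (16 * A ^ 2 - 32 * A ^ 3 + 16 * A ^ 4) * p5 - k * r0)
    (2 * A * p2 + (-8 * A + 32 * A ^ 2 - 24 * A ^ 3) * p4 - k * r1)
    ((1 - 6 * A + 8 * A ^ 2) * p3 + (16 * A - 120 * A ^ 2 + 232 * A ^ 3 - 128 * A ^ 4) * p5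
      - k * r2)
    ((12 * A - 40 * A ^ 2 + 32 * A ^ 3) * p4 - k * r3)
    ((1 - 20 * A + 120 * A ^ 2 - 224 * A ^ 3 + 128 * A ^ 4) * p5 - k * r4)
    (by
      simp only [C_sub, C_add, C_neg, C_pow, C_1, C_mul, C_ofNat] at h ⊢
      linear_combination h)
  exact ⟨sub_eq_zero.mp e4, sub_eq_zero.mp e3, sub_eq_zero.mp e2, sub_eq_zero.mp e1,
    sub_eq_zero.mp e0⟩

/-- The recurrence coefficients. -/
lemma Rules.coefs (R : Rules a D S) (A : ℂ) (hA : a ^ 2 = A) (A0 : A ≠ 0) (A1 : A - 1 ≠ 0)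
    (A2 : 2 * A - 1 ≠ 0) (A4 : 4 * A - 1 ≠ 0) (A3 : 4 * A - 3 ≠ 0)
    (P : ℕ → ℂ[X]) (k : ℕ → ℂ) (hAp : AppellSD S D P k)
    (B0 B1 B2 B3 B4 C1 C2 C3 C4 : ℂ) (hC1 : C1 ≠ 0)
    (h0 : P 0 = 1) (h1 : P 1 = X - C B0)
    (h2 : P 2 = (X - C B1) * P 1 - C C1 * P 0)
    (h3 : P 3 = (X - C B2) * P 2 - C C2 * P 1)
    (h4 : P 4 = (X - C B3) * P 3 - C C3 * P 2)
    (h5 : P 5 = (X - C B4) * P 4 - C C4 * P 3) :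
    B0 = 0 ∧ B1 = 0 ∧ B2 = 0 ∧ C1 ^ 2 - 2 * (1 - A) * C1 + (1 - A) = 0 ∧
    C2 = 4 * A * (1 - A) + (8 * A ^ 2 - 6 * A) * C1 ∧
    C3 = -4 + 36 * A - 112 * A ^ 2 + 144 * A ^ 3 - 64 * A ^ 4
      + (5 - 50 * A + 176 * A ^ 2 - 256 * A ^ 3 + 128 * A ^ 4) * C1 ∧
    k 1 = 1 ∧ k 2 = 2 * A ∧ k 3 = 1 - 6 * A + 8 * A ^ 2 := by
  rw [h1, h0] at h2
  rw [h2, h1] at h3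
  rw [h3, h2] at h4
  rw [h4, h3] at h5
  have E1 := R.five A hA 0 0 0 0 1 (-B0) 0 0 0 0 1 (k 1) (P 1) (P 0)
    (by rw [h1]; simp only [C_neg, C_0, C_1]; ring) (by rw [h0]; simp) (hAp.2 0)
  have E2 := R.five A hA 0 0 0 1 (-B0 - B1) (B0 * B1 - C1) 0 0 0 1 (-B0) (k 2) (P 2) (P 1)
    (by rw [h2]; simp only [C_sub, C_mul, C_neg, C_0, C_1]; ring)
    (by rw [h1]; simp only [C_neg, C_0, C_1]; ring) (hAp.2 1)
  have k1 : k 1 = 1 := by linear_combination -E1.2.2.2.2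
  have k2 : k 2 = 2 * A := by linear_combination -E2.2.2.2.1
  have b1 : B1 = (2 * A - 1) * B0 := by
    have := E2.2.2.2.2; rw [k2] at this; linear_combination -this
  clear E1 E2
  have E3 := R.five A hA 0 0 1 (-B0 - B1 - B2) (B0 * B1 - C1 + B2 * (B0 + B1) - C2)
    (-B2 * (B0 * B1 - C1) + C2 * B0) 0 0 1 (-B0 - B1) (B0 * B1 - C1) (k 3) (P 3) (P 2)
    (by rw [h3]; simp only [C_sub, C_add, C_mul, C_neg, C_0, C_1]; ring)
    (by rw [h2]; simp only [C_sub, C_mul, C_neg, C_0, C_1]; ring) (hAp.2 2)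
  obtain ⟨-, -, e2, e1, e0⟩ := E3
  have k3 : k 3 = 1 - 6 * A + 8 * A ^ 2 := by linear_combination -e2
  rw [k3, b1] at e1 e0
  have b2 : B2 = (1 - 8 * A + 8 * A ^ 2) * B0 := by
    have h2A : (2 * A) ≠ 0 := mul_ne_zero two_ne_zero A0
    apply mul_left_cancel₀ h2A
    linear_combination -e1
  rw [b2] at e0
  have c2 : C2 = 4 * A - 4 * A ^ 2 + (-6 * A + 8 * A ^ 2) * C1 + (-4 * A + 4 * A ^ 2) * B0 ^ 2 := by
    linear_combination -e0
  clear e0 e1 e2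
  have E4 := R.five A hA 0 1 (-B0 - B1 - B2 - B3)
    (B0 * B1 - C1 + B2 * (B0 + B1) - C2 - B3 * (-B0 - B1 - B2) - C3)
    (-B2 * (B0 * B1 - C1) + C2 * B0 - B3 * (B0 * B1 - C1 + B2 * (B0 + B1) - C2)
      - C3 * (-B0 - B1))
    (-B3 * (-B2 * (B0 * B1 - C1) + C2 * B0) - C3 * (B0 * B1 - C1))
    0 1 (-B0 - B1 - B2) (B0 * B1 - C1 + B2 * (B0 + B1) - C2)
    (-B2 * (B0 * B1 - C1) + C2 * B0) (k 4) (P 4) (P 3)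
    (by rw [h4]; simp only [C_sub, C_add, C_mul, C_neg, C_0, C_1]; ring)
    (by rw [h3]; simp only [C_sub, C_add, C_mul, C_neg, C_0, C_1]; ring) (hAp.2 3)
  obtain ⟨-, e3, e2, e1, e0⟩ := E4
  have k4 : k 4 = 12 * A - 40 * A ^ 2 + 32 * A ^ 3 := by linear_combination -e3
  rw [k4, b1, b2] at e2
  have K3 : (1 - 6 * A + 8 * A ^ 2) ≠ 0 := by
    have : (1 - 6 * A + 8 * A ^ 2) = (4 * A - 1) * (2 * A - 1) := by ring
    rw [this]; exact mul_ne_zero A4 A2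
  have b3 : B3 = (-1 + 18 * A - 48 * A ^ 2 + 32 * A ^ 3) * B0 := by
    apply mul_left_cancel₀ K3
    linear_combination -e2
  rw [k4, b1, b2, b3, c2] at e1 e0
  have c3 : C3 = -4 + 36 * A - 112 * A ^ 2 + 144 * A ^ 3 - 64 * A ^ 4
      + (5 - 50 * A + 176 * A ^ 2 - 256 * A ^ 3 + 128 * A ^ 4) * C1
      + (4 - 36 * A + 112 * A ^ 2 - 144 * A ^ 3 + 64 * A ^ 4) * B0 ^ 2 := by
    have h2A : (2 * A) ≠ 0 := mul_ne_zero two_ne_zero A0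
    apply mul_left_cancel₀ h2A
    linear_combination -e1
  rw [c3] at e0
  have con4 : 8 * A * (A - 1) * (4 * A - 1) * (B0 * ((A - 1) * (1 - B0 ^ 2) + C1)) = 0 := by
    linear_combination e0
  clear e0 e1 e2 e3
  have E5 := R.five A hA 1 (-B0 - B1 - B2 - B3 - B4)
    (B0 * B1 - C1 + B2 * (B0 + B1) - C2 - B3 * (-B0 - B1 - B2) - C3
      - B4 * (-B0 - B1 - B2 - B3) - C4)
    (-B2 * (B0 * B1 - C1) + C2 * B0 - B3 * (B0 * B1 - C1 + B2 * (B0 + B1) - C2)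
      - C3 * (-B0 - B1)
      - B4 * (B0 * B1 - C1 + B2 * (B0 + B1) - C2 - B3 * (-B0 - B1 - B2) - C3)
      - C4 * (-B0 - B1 - B2))
    (-B3 * (-B2 * (B0 * B1 - C1) + C2 * B0) - C3 * (B0 * B1 - C1)
      - B4 * (-B2 * (B0 * B1 - C1) + C2 * B0 - B3 * (B0 * B1 - C1 + B2 * (B0 + B1) - C2)
      - C3 * (-B0 - B1)) - C4 * (B0 * B1 - C1 + B2 * (B0 + B1) - C2))
    (-B4 * (-B3 * (-B2 * (B0 * B1 - C1) + C2 * B0) - C3 * (B0 * B1 - C1))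
      - C4 * (-B2 * (B0 * B1 - C1) + C2 * B0))
    1 (-B0 - B1 - B2 - B3)
    (B0 * B1 - C1 + B2 * (B0 + B1) - C2 - B3 * (-B0 - B1 - B2) - C3)
    (-B2 * (B0 * B1 - C1) + C2 * B0 - B3 * (B0 * B1 - C1 + B2 * (B0 + B1) - C2)
      - C3 * (-B0 - B1))
    (-B3 * (-B2 * (B0 * B1 - C1) + C2 * B0) - C3 * (B0 * B1 - C1))
    (k 5) (P 5) (P 4)
    (by rw [h5]; simp only [C_sub, C_add, C_mul, C_neg, C_0, C_1]; ring)
    (by rw [h4]; simp only [C_sub, C_add, C_mul, C_neg, C_0, C_1]; ring) (hAp.2 4)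
  obtain ⟨e4, e3, e2, -, e0⟩ := E5
  have k5 : k 5 = 1 - 20 * A + 120 * A ^ 2 - 224 * A ^ 3 + 128 * A ^ 4 := by
    linear_combination -e4
  rw [k5, b1, b2, b3] at e3
  have K4 : (12 * A - 40 * A ^ 2 + 32 * A ^ 3) ≠ 0 := by
    have : (12 * A - 40 * A ^ 2 + 32 * A ^ 3) = 4 * A * (4 * A - 3) * (2 * A - 1) := by ring
    rw [this]
    exact mul_ne_zero (mul_ne_zero (mul_ne_zero (by norm_num) A0) A3) A2
  have b4 : B4 = (1 - 32 * A + 160 * A ^ 2 - 256 * A ^ 3 + 128 * A ^ 4) * B0 := by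
    apply mul_left_cancel₀ K4
    linear_combination -e3
  rw [k5, b1, b2, b3, b4, c2, c3] at e2 e0
  have c4 : C4 = 72 * A - 696 * A ^ 2 + 2480 * A ^ 3 - 4160 * A ^ 4 + 3328 * A ^ 5 - 1024 * A ^ 6
      + (-84 * A + 952 * A ^ 2 - 3808 * A ^ 3 + 7040 * A ^ 4 - 6144 * A ^ 5 + 2048 * A ^ 6) * C1
      + (-72 * A + 696 * A ^ 2 - 2480 * A ^ 3 + 4160 * A ^ 4 - 3328 * A ^ 5 + 1024 * A ^ 6)
        * B0 ^ 2 := by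
    apply mul_left_cancel₀ K3
    linear_combination -e2
  rw [c4] at e0
  clear e2 e3 e4
  have hne : 8 * A * (A - 1) * (4 * A - 1) ≠ 0 :=
    mul_ne_zero (mul_ne_zero (mul_ne_zero (by norm_num) A0) A1) A4
  have hB : B0 = 0 := by
    rcases mul_eq_zero.mp ((mul_eq_zero.mp con4).resolve_left hne) with h | h
    · exact h
    · exfalso
      have hC : C1 = (1 - A) * (1 - B0 ^ 2) := by linear_combination h
      rw [hC] at e0
      have hz : (-256 * A ^ 2 * (A - 1) ^ 2 * (A - 1 / 4) * (A - 1 / 2) ^ 2)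
          * (1 - B0 ^ 2) ^ 2 = 0 := by
        linear_combination e0
      have hn : (-256 * A ^ 2 * (A - 1) ^ 2 * (A - 1 / 4) * (A - 1 / 2) ^ 2) ≠ 0 := by
        have : (-256 * A ^ 2 * (A - 1) ^ 2 * (A - 1 / 4) * (A - 1 / 2) ^ 2)
          = -16 * A ^ 2 * (A - 1) ^ 2 * (4 * A - 1) * (2 * A - 1) ^ 2 := by ring
        rw [this]
        exact mul_ne_zero (mul_ne_zero (mul_ne_zero (mul_ne_zero (by norm_num)
          (pow_ne_zero _ A0)) (pow_ne_zero _ A1)) A4) (pow_ne_zero _ A2)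
      have hb := pow_eq_zero_iff (two_ne_zero) |>.mp ((mul_eq_zero.mp hz).resolve_left hn)
      apply hC1
      rw [hC, hb, mul_zero]
  rw [hB] at b1 b2 c2 c3 e0
  refine ⟨hB, by rw [b1]; ring, by rw [b2]; ring, ?_, by rw [c2]; ring, by rw [c3]; ring,
    k1, k2, k3⟩
  have hn : 16 * A * (A - 1) * (4 * A - 1) * (2 * A - 1) ^ 2 ≠ 0 :=
    mul_ne_zero (mul_ne_zero (mul_ne_zero (mul_ne_zero (by norm_num) A0) A1) A4)
      (pow_ne_zero _ A2)
  apply mul_left_cancel₀ hn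
  linear_combination e0

end scalars

end AWaux

namespace AWaux

lemma final {D S : ℂ[X] → ℂ[X]} {a : ℂ} (R : Rules a D S) (u : ℂ[X] →ₗ[ℂ] ℂ) (r : ℂ)
    (hr : r ≠ 0) (hr1 : 1 - r ^ 2 ≠ 0) (ha : a = (r + r⁻¹) / 2)
    (A0 : a ^ 2 ≠ 0) (A2 : 2 * a ^ 2 - 1 ≠ 0) (A4 : 4 * a ^ 2 - 1 ≠ 0)
    (C1 C2 C3 : ℂ) (hC1 : C1 = (1 - r ^ 2) / 2)
    (hC2 : C2 = 4 * a ^ 2 * (1 - a ^ 2) + (8 * (a ^ 2) ^ 2 - 6 * a ^ 2) * C1)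
    (hC3 : C3 = -4 + 36 * a ^ 2 - 112 * (a ^ 2) ^ 2 + 144 * (a ^ 2) ^ 3 - 64 * (a ^ 2) ^ 4
      + (5 - 50 * a ^ 2 + 176 * (a ^ 2) ^ 2 - 256 * (a ^ 2) ^ 3 + 128 * (a ^ 2) ^ 4) * C1)
    (F0 : ∀ f, C1 * u (S (D f)) = u (X * f))
    (F1 : ∀ f, C2 * u (X * S (D f)) = 2 * a ^ 2 * u ((X ^ 2 - C C1) * f))
    (F2 : ∀ f, C3 * u ((X ^ 2 - C C1) * S (D f))
      = (1 - 6 * a ^ 2 + 8 * (a ^ 2) ^ 2) * u ((X ^ 3 - C (C1 + C2) * X) * f)) :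
    (∀ f, (r ^ 2 - 1) * (-(u (S (D f)))) = 2 * u (X * f)) ∧
    (∀ f, 2 * r ^ 3 * u (C (a ^ 2 - 1) * (X ^ 2 - 1) * D (D f))
      = -(u ((2 * X ^ 2 + C (r ^ 2 - 1)) * f))) ∧
    (∀ f, 2 * r ^ 2 * u (S (S f)) = u ((-(2 : ℂ[X]) * X ^ 2 + C (1 + r ^ 2)) * f)) ∧
    (∀ f, 8 * r ^ 5 * (-(u (C (a ^ 2 - 1) * (X ^ 2 - 1) * D (S f))))
      = u ((C (1 - r ^ 2) * X * (-(4 : ℂ[X]) * X ^ 2 + C (r ^ 4 + 3))) * f)) := by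
  have ea : a = (r ^ 2 + 1) / (2 * r) := by rw [ha]; field_simp
  have ha0 : a ≠ 0 := fun h => A0 (by rw [h]; ring)
  have Q1 : r ^ 2 + 1 ≠ 0 := by
    intro h; apply ha0; rw [ea, h]; simp
  have Q2 : r ^ 4 + 1 ≠ 0 := by
    intro h; apply A2
    have : 2 * a ^ 2 - 1 = (r ^ 4 + 1) / (2 * r ^ 2) := by rw [ea]; field_simp; ring
    rw [this, h]; simp
  have K3 : (1 - 6 * a ^ 2 + 8 * (a ^ 2) ^ 2) ≠ 0 := by
    have : (1 - 6 * a ^ 2 + 8 * (a ^ 2) ^ 2) = (4 * a ^ 2 - 1) * (2 * a ^ 2 - 1) := by ring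
    rw [this]; exact mul_ne_zero A4 A2
  have hC2' : 2 * C2 = r ^ 2 * (1 - r ^ 2) * (2 * a ^ 2) := by
    rw [hC2, hC1, ea]; field_simp; ring
  have hC3' : 2 * C3 = r ^ 4 * (1 - r ^ 2) * (1 - 6 * a ^ 2 + 8 * (a ^ 2) ^ 2) := by
    rw [hC3, hC1, ea]; field_simp; ring
  have hC2s : C2 = (1 + r ^ 2) ^ 2 * (1 - r ^ 2) / 4 := by
    rw [hC2, hC1, ea]; field_simp; ring
  -- normalised forms
  have G0 : ∀ f, u (S (D f)) = 2 * u (X * f) / (1 - r ^ 2) := by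
    intro f; rw [eq_div_iff hr1, ← F0, hC1]; ring
  have G1 : ∀ f, u (X * S (D f)) = 2 * (u (X ^ 2 * f) - C1 * u f) / (r ^ 2 * (1 - r ^ 2)) := by
    intro f
    rw [eq_div_iff (mul_ne_zero (pow_ne_zero _ hr) hr1)]
    have h := F1 f
    rw [sub_mul, map_sub, uC] at h
    apply mul_left_cancel₀ (mul_ne_zero two_ne_zero A0)
    linear_combination 2 * h - u (X * S (D f)) * hC2'
  have G2 : ∀ f, u (X ^ 2 * S (D f)) = 2 * (u (X ^ 3 * f) - (C1 + C2) * u (X * f))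
      / (r ^ 4 * (1 - r ^ 2)) + C1 * u (S (D f)) := by
    intro f
    rw [← sub_eq_iff_eq_add, eq_div_iff (mul_ne_zero (pow_ne_zero _ hr) hr1)]
    have h := F2 f
    rw [sub_mul, sub_mul, map_sub, map_sub, uC, mul_assoc (C _), uC] at h
    apply mul_left_cancel₀ K3
    linear_combination 2 * h - (u (X ^ 2 * S (D f)) - C1 * u (S (D f))) * hC3'
  have Hs : ∀ f, u (S (S f)) = u f + (a ^ 2 - 1) * u (X * S (D f))
      + a * u (C (a ^ 2 - 1) * (X ^ 2 - 1) * D (D f)) := by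
    intro f
    rw [(R.comm f).2, map_add, map_add, mul_assoc, uC, mul_assoc (C a), uC]
  have Hp : ∀ f, u (S (D (X * f))) = u (S (S f)) + a ^ 2 * u (X * S (D f))
      + a * u (C (a ^ 2 - 1) * (X ^ 2 - 1) * D (D f)) := by
    intro f
    rw [R.SDX, map_add, map_add, mul_assoc, uC, mul_assoc (C a), uC]
  have Hd : ∀ f, u (C (a ^ 2 - 1) * (X ^ 2 - 1) * D (D f))
      = -(2 * u (X ^ 2 * f) + (r ^ 2 - 1) * u f) / (2 * r ^ 3) := by
    intro f
    have h1 := Hs f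
    have h2 := Hp f
    have hX : (X * (X * f) : ℂ[X]) = X ^ 2 * f := by ring
    rw [G0, hX] at h2
    rw [G1] at h1 h2
    apply mul_left_cancel₀ (mul_ne_zero two_ne_zero ha0)
    have h3 : 2 * a * u (C (a ^ 2 - 1) * (X ^ 2 - 1) * D (D f))
        = 2 * u (X ^ 2 * f) / (1 - r ^ 2) - u f - (2 * a ^ 2 - 1) *
          (2 * (u (X ^ 2 * f) - C1 * u f) / (r ^ 2 * (1 - r ^ 2))) := by
      linear_combination -h1 - h2
    rw [h3, hC1, ea]
    field_simp
    ring
  refine ⟨?_, ?_, ?_, ?_⟩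
  · intro f; rw [G0]; field_simp; ring
  · intro f
    have e : (2 * X ^ 2 + C (r ^ 2 - 1)) * f = C 2 * (X ^ 2 * f) + C (r ^ 2 - 1) * f := by
      rw [C_ofNat]; ring
    rw [e, map_add, uC, uC, Hd]; field_simp
  · intro f
    have e : (-(2 : ℂ[X]) * X ^ 2 + C (1 + r ^ 2)) * f
        = C (-2) * (X ^ 2 * f) + C (1 + r ^ 2) * f := by
      rw [C_neg, C_ofNat]; ring
    rw [e, map_add, uC, uC, Hs, Hd, G1, hC1, ea]; field_simp; ring
  · intro f
    have e : (C (1 - r ^ 2) * X * (-(4 : ℂ[X]) * X ^ 2 + C (r ^ 4 + 3))) * f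
        = C (-4 * (1 - r ^ 2)) * (X ^ 3 * f) + C ((1 - r ^ 2) * (r ^ 4 + 3)) * (X * f) := by
      simp only [C_mul, C_neg, C_ofNat]; ring
    have hX : (X ^ 2 * (X * f) : ℂ[X]) = X ^ 3 * f := by ring
    have h1 := Hd (X * f)
    have e1 : C (a ^ 2 - 1) * (X ^ 2 - 1) * D (D (X * f))
        = C (2 * a * (a ^ 2 - 1)) * (X ^ 2 * S (D f)) - C (2 * a * (a ^ 2 - 1)) * S (D f)
          + C (2 * a ^ 2 - 1) * (X * (C (a ^ 2 - 1) * (X ^ 2 - 1) * D (D f))) := by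
      rw [R.DDX]; simp only [C_sub, C_pow, C_1, C_mul, C_ofNat]; ring
    have e2 : C (a ^ 2 - 1) * (X ^ 2 - 1) * D (S f)
        = C (a * (a ^ 2 - 1)) * (X ^ 2 * S (D f)) - C (a * (a ^ 2 - 1)) * S (D f)
          + C (a ^ 2 - 1) * (X * (C (a ^ 2 - 1) * (X ^ 2 - 1) * D (D f))) := by
      rw [(R.comm f).1]; simp only [C_sub, C_pow, C_1, C_mul, C_ofNat]; ring
    rw [e1, hX, map_add, map_sub, uC, uC, uC, G2, G0] at h1
    rw [e, e2, map_add, map_sub, map_add, uC, uC, uC, uC, uC, G2, G0]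
    generalize u (X * (C (a ^ 2 - 1) * (X ^ 2 - 1) * D (D f))) = d at h1 ⊢
    generalize u (X ^ 3 * f) = m3 at h1 ⊢
    generalize u (X * f) = m1 at h1 ⊢
    rw [hC2s, hC1] at h1 ⊢
    apply mul_left_cancel₀ A2
    have h2 := eq_sub_of_add_eq' h1
    have h3 : ∀ x : ℂ, (2 * a ^ 2 - 1) * (8 * r ^ 5 * -(x + (a ^ 2 - 1) * d))
        = 8 * r ^ 5 * -((2 * a ^ 2 - 1) * x + (a ^ 2 - 1) * ((2 * a ^ 2 - 1) * d)) := by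
      intro x; ring
    rw [h3, h2, ea]
    field_simp
    ring

end AWaux
/-- if the monic OPS of a regular functional `u` satisfies
`𝒮_q(𝒟_q P_n) = k_n P_{n-1}`, then there is `s = ±1` such that `u` satisfies
the four functional equations \eqref{funct-eq1}-\eqref{funct-eq4}
(stated here pointwise against every polynomial `f`). -/
theorem stmt_9 (q : ℝ) (hq0 : 0 < q) (hq1 : q < 1)
    (Dq Sq : ℂ[X] → ℂ[X]) (hD : IsAW q Dq) (hS : IsAv q Sq)
    (u : ℂ[X] →ₗ[ℂ] ℂ) (P : ℕ → ℂ[X])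
    (hmonic : ∀ n, (P n).Monic) (hdeg : ∀ n, (P n).natDegree = n)
    (horth : ∀ m n : ℕ, m ≠ n → u (P m * P n) = 0)
    (hreg : ∀ n : ℕ, u (P n ^ 2) ≠ 0)
    (k : ℕ → ℂ) (hAp : AppellSD Sq Dq P k) :
    ∃ s : ℤ, (s = 1 ∨ s = -1) ∧
      (∀ f : ℂ[X],
        ((q : ℂ) ^ s - 1) * (-(u (Sq (Dq f)))) = 2 * u (X * f)) ∧
      (∀ f : ℂ[X],
        2 * (qh q) ^ (3 * s) * u (U2 q * Dq (Dq f)) =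
          -(u ((2 * X ^ 2 + Polynomial.C ((q : ℂ) ^ s - 1)) * f))) ∧
      (∀ f : ℂ[X],
        2 * (q : ℂ) ^ s * u (Sq (Sq f)) =
          u ((-(2 : ℂ[X]) * X ^ 2 + Polynomial.C (1 + (q : ℂ) ^ s)) * f)) ∧
      (∀ f : ℂ[X],
        8 * (qh q) ^ (5 * s) * (-(u (U2 q * Dq (Sq f)))) =
          u ((Polynomial.C (1 - (q : ℂ) ^ s) * X *
            (-(4 : ℂ[X]) * X ^ 2 + Polynomial.C ((q : ℂ) ^ (2 * s) + 3))) * f)) := by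
  have hqh : (qh q) ^ 2 = (q : ℂ) := by
    unfold qh; rw [← Complex.ofReal_pow, Real.sq_sqrt hq0.le]
  have hr0 : qh q ≠ 0 := by
    intro h; rw [h] at hqh
    have : (q : ℂ) ≠ 0 := by exact_mod_cast hq0.ne'
    exact this (by rw [← hqh]; ring)
  have hr1 : (qh q) ^ 2 ≠ 1 := by
    rw [hqh]; exact_mod_cast hq1.ne
  have R := AWaux.rules_of q hr0 hr1 Dq Sq hD hS
  -- `A = α²` is a real number bigger than one
  obtain ⟨x, hx1, hx⟩ : ∃ x : ℝ, 1 < x ∧ (alp q) ^ 2 = (x : ℂ) := by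
    refine ⟨(1 + q) ^ 2 / (4 * q), ?_, ?_⟩
    · rw [lt_div_iff₀ (by positivity)]
      nlinarith [sq_pos_of_pos (sub_pos.mpr hq1)]
    · have : alp q = ((qh q) ^ 2 + 1) / (2 * qh q) := by unfold alp; field_simp
      rw [this, div_pow, mul_pow, hqh]; push_cast; ring
  have A0 : (alp q) ^ 2 ≠ 0 := by
    have : x ≠ 0 := by linarith
    rw [hx]; exact_mod_cast this
  have A1 : (alp q) ^ 2 - 1 ≠ 0 := by
    have : x - 1 ≠ 0 := by linarith
    rw [hx]; exact_mod_cast this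
  have A2 : 2 * (alp q) ^ 2 - 1 ≠ 0 := by
    have : 2 * x - 1 ≠ 0 := by linarith
    rw [hx]; exact_mod_cast this
  have A4 : 4 * (alp q) ^ 2 - 1 ≠ 0 := by
    have : 4 * x - 1 ≠ 0 := by linarith
    rw [hx]; exact_mod_cast this
  have A3 : 4 * (alp q) ^ 2 - 3 ≠ 0 := by
    have : 4 * x - 3 ≠ 0 := by linarith
    rw [hx]; exact_mod_cast this
  -- recurrence coefficients
  have h0 : P 0 = 1 := (hmonic 0).natDegree_eq_zero.mp (hdeg 0)
  obtain ⟨B0, h1⟩ : ∃ B0, P 1 = X - C B0 := by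
    refine ⟨-(P 1).coeff 0, ?_⟩
    have h := Polynomial.eq_X_add_C_of_natDegree_le_one (hdeg 1).le
    have hl : (P 1).coeff 1 = 1 := by
      have := hmonic 1
      rwa [Polynomial.Monic, Polynomial.leadingCoeff, hdeg 1] at this
    rw [hl] at h
    rw [C_neg, sub_neg_eq_add]
    simpa using h
  obtain ⟨B1, C1, hC1, hu1, h2⟩ := AWaux.ttrr hmonic hdeg horth hreg 0
  obtain ⟨B2, C2, hC2, hu2, h3⟩ := AWaux.ttrr hmonic hdeg horth hreg 1
  obtain ⟨B3, C3, hC3, hu3, h4⟩ := AWaux.ttrr hmonic hdeg horth hreg 2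
  obtain ⟨B4, C4, hC4, hu4, h5⟩ := AWaux.ttrr hmonic hdeg horth hreg 3
  simp only [zero_add, Nat.reduceAdd] at h2 h3 h4 h5 hu1 hu2 hu3 hu4
  obtain ⟨b0, b1, b2, hquad, c2, c3, k1, k2, k3⟩ := R.coefs _ rfl A0 A1 A2 A4 A3 P k hAp
    B0 B1 B2 B3 B4 C1 C2 C3 C4 hC1 h0 h1 h2 h3 h4 h5
  have e1 : P 1 = X := by rw [h1, b0]; simp
  have e2 : P 2 = X ^ 2 - C C1 := by rw [h2, e1, h0, b1, C_0]; ring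
  have e3 : P 3 = X ^ 3 - C (C1 + C2) * X := by rw [h3, e1, e2, b2, C_0, C_add]; ring
  have F0 : ∀ f, C1 * u (Sq (Dq f)) = u (X * f) := by
    intro f
    have h := AWaux.key hmonic hdeg horth R k hAp 0 C1 hu1 f
    simp only [zero_add, Nat.reduceAdd] at h
    rw [h0, e1, k1, one_mul, one_mul] at h
    exact h
  have F1 : ∀ f, C2 * u (X * Sq (Dq f)) = 2 * (alp q) ^ 2 * u ((X ^ 2 - C C1) * f) := by
    intro f
    have h := AWaux.key hmonic hdeg horth R k hAp 1 C2 hu2 f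
    simp only [Nat.reduceAdd] at h
    rw [e1, e2, k2] at h
    exact h
  have F2 : ∀ f, C3 * u ((X ^ 2 - C C1) * Sq (Dq f))
      = (1 - 6 * (alp q) ^ 2 + 8 * ((alp q) ^ 2) ^ 2) * u ((X ^ 3 - C (C1 + C2) * X) * f) := by
    intro f
    have h := AWaux.key hmonic hdeg horth R k hAp 2 C3 hu3 f
    simp only [Nat.reduceAdd] at h
    rw [e2, e3, k3] at h
    exact h
  have hfac : (C1 - (1 - (qh q) ^ 2) / 2) * (C1 - (1 - ((qh q)⁻¹) ^ 2) / 2) = 0 := by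
    have hv : qh q * (qh q)⁻¹ = 1 := mul_inv_cancel₀ hr0
    rw [← hquad]
    unfold alp
    generalize (qh q)⁻¹ = v at *
    generalize qh q = r at *
    linear_combination (-C1 + (r * v + 1) / 4 + 1 / 2) * hv
  rcases mul_eq_zero.mp hfac with h | h
  · refine ⟨1, Or.inl rfl, ?_⟩
    obtain ⟨g1, g2, g3, g4⟩ := AWaux.final R u (qh q) hr0 (sub_ne_zero.mpr hr1.symm) rfl A0 A2 A4
      C1 C2 C3 (sub_eq_zero.mp h) c2 c3 F0 F1 F2
    have z1 : (q : ℂ) ^ (1 : ℤ) = (qh q) ^ 2 := by rw [hqh, zpow_one]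
    have z2 : (q : ℂ) ^ (2 * 1 : ℤ) = (qh q) ^ 4 := by
      rw [← hqh, mul_one]; norm_cast; ring
    have z3 : (qh q) ^ (3 * 1 : ℤ) = (qh q) ^ 3 := by norm_cast
    have z5 : (qh q) ^ (5 * 1 : ℤ) = (qh q) ^ 5 := by norm_cast
    rw [z1, z2, z3, z5]
    exact ⟨g1, g2, g3, g4⟩
  · refine ⟨-1, Or.inr rfl, ?_⟩
    have hi0 : (qh q)⁻¹ ≠ 0 := inv_ne_zero hr0
    have hi1 : 1 - ((qh q)⁻¹) ^ 2 ≠ 0 := by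
      intro hh
      apply hr1
      rw [inv_pow, sub_eq_zero] at hh
      exact inv_eq_one.mp hh.symm
    have hal : alp q = ((qh q)⁻¹ + ((qh q)⁻¹)⁻¹) / 2 := by
      unfold alp; rw [inv_inv]; ring
    obtain ⟨g1, g2, g3, g4⟩ := AWaux.final R u (qh q)⁻¹ hi0 hi1 hal A0 A2 A4
      C1 C2 C3 (sub_eq_zero.mp h) c2 c3 F0 F1 F2
    have z1 : (q : ℂ) ^ (-1 : ℤ) = ((qh q)⁻¹) ^ 2 := by rw [← hqh, zpow_neg_one, inv_pow]
    have z2 : (q : ℂ) ^ (2 * -1 : ℤ) = ((qh q)⁻¹) ^ 4 := by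
      rw [zpow_mul', z1]; norm_cast; ring
    have z3 : (qh q) ^ (3 * -1 : ℤ) = ((qh q)⁻¹) ^ 3 := by
      rw [zpow_mul', zpow_neg_one]; norm_cast
    have z5 : (qh q) ^ (5 * -1 : ℤ) = ((qh q)⁻¹) ^ 5 := by
      rw [zpow_mul', zpow_neg_one]; norm_cast
    rw [z1, z2, z3, z5]
    exact ⟨g1, g2, g3, g4⟩
end

section
/- Let u be a regular linear functional on ℂ[z] with monic OPS (P_n)_{n≥0}, and suppose that for some s ∈ {1, −1} the functional u satisfies the four equations: (q^s − 1)·𝐃_q(𝐒_q u) = 2·(z·u); 2q^{3s/2}·𝐃_q(𝐃_q(U₂·u)) = −((2z² + q^s − 1)·u); 2q^s·𝐒_q(𝐒_q u) = (−2z² + 1 + q^s)·u; and 8q^{5s/2}·𝐒_q(𝐃_q(U₂·u)) = ((1 − q^s)·z·(−4z² + q^{2s} + 3))·u. Then the recurrence coefficients of (P_n) are B_n = 0 and C_{n+1} = (1/4)(1 − q^{s(n+1)})(1 + q^{sn}) for all n ≥ 0, i.e. P_n is the Al-Salam–Chihara polynomial Q_n(z; s, −s | q^s), and 𝒮_q(𝒟_q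 P_n) = γ_n α_{n−1} P_{n−1} for all n ≥ 1. -/
open Polynomial

namespace Helper10

noncomputable section

/-- `k_n = γ_n α_{n-1}` in terms of `Q`. -/
def kk (Q : ℂ) (n : ℤ) : ℂ := (Q ^ n + Q - 1 - Q * (Q ^ n)⁻¹) / (2 * (Q - 1))

/-- the recurrence coefficients. -/
def cc (Q : ℂ) (n : ℤ) : ℂ := (1 - Q ^ n) * (1 + Q ^ n * Q⁻¹) / 4

/-- the constant `κ`. -/
def ka (Q : ℂ) : ℂ := (Q + Q⁻¹ - 2) / 2

/-- the monic Al-Salam–Chihara polynomials. -/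
def QQ (Q : ℂ) : ℕ → ℂ[X]
  | 0 => 1
  | 1 => X
  | (n + 2) => X * QQ Q (n + 1) - Polynomial.C (cc Q ((n : ℤ) + 1)) * QQ Q n

lemma id1 (Q : ℂ) (h0 : Q ≠ 0) (h1 : Q - 1 ≠ 0) (n : ℤ) :
    (2 + 2 * ka Q) * kk Q (n + 1) - kk Q n - ka Q - kk Q (n + 2) = 0 := by
  have ht : Q ^ n ≠ 0 := zpow_ne_zero _ h0
  simp only [ka, kk, zpow_add₀ h0, zpow_one, zpow_ofNat]
  generalize Q ^ n = t at *
  field_simp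
  ring

lemma id2 (Q : ℂ) (h0 : Q ≠ 0) (h1 : Q - 1 ≠ 0) (n : ℤ) :
    (2 + 2 * ka Q) * (kk Q (n + 1) * cc Q n + cc Q n * kk Q (n - 1))
      - kk Q n * (cc Q n + cc Q (n - 1)) - (2 * ka Q + ka Q ^ 2) * kk Q n - ka Q * cc Q n
      - (cc Q (n + 1) + cc Q n) * kk Q n = 0 := by
  have ht : Q ^ n ≠ 0 := zpow_ne_zero _ h0
  simp only [ka, kk, cc, zpow_add₀ h0, zpow_sub₀ h0, zpow_one, zpow_ofNat]
  generalize Q ^ n = t at *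
  field_simp
  ring

lemma id3 (Q : ℂ) (h0 : Q ≠ 0) (h1 : Q - 1 ≠ 0) (n : ℤ) :
    (2 + 2 * ka Q) * (cc Q n * kk Q (n - 1) * cc Q (n - 2))
      - kk Q n * cc Q (n - 1) * cc Q (n - 2) - cc Q n * cc Q (n - 1) * kk Q (n - 2) = 0 := by
  have ht : Q ^ n ≠ 0 := zpow_ne_zero _ h0
  simp only [ka, kk, cc, zpow_sub₀ h0, zpow_one, zpow_ofNat]
  generalize Q ^ n = t at *
  field_simp
  ring

lemma cc0 (Q : ℂ) : cc Q 0 = 0 := by simp [cc]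
lemma kk0 (Q : ℂ) : kk Q 0 = 0 := by simp [kk]
lemma kk1 (Q : ℂ) (h1 : Q - 1 ≠ 0) (h0 : Q ≠ 0) : kk Q 1 = 1 := by
  simp only [kk, zpow_one]
  field_simp
  ring
lemma cc1 (Q : ℂ) (h0 : Q ≠ 0) : cc Q 1 = (1 - Q) / 2 := by
  simp only [cc, zpow_one]
  field_simp
  ring

lemma QQ0 (Q : ℂ) : QQ Q 0 = 1 := by simp [QQ]
lemma QQ1 (Q : ℂ) : QQ Q 1 = X := by simp [QQ]
lemma QQr (Q : ℂ) (n : ℕ) : QQ Q (n + 2) =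
    X * QQ Q (n + 1) - Polynomial.C (cc Q ((n : ℤ) + 1)) * QQ Q n := by simp [QQ]

/-- Appell property for an abstract operator `N`. -/
lemma appell (Q : ℂ) (h0 : Q ≠ 0) (h1 : Q - 1 ≠ 0) (N : ℂ[X] →ₗ[ℂ] ℂ[X])
    (N1 : N 1 = 0) (NX : N X = 1)
    (hN : ∀ g, N (X ^ 2 * g) = Polynomial.C (2 + 2 * ka Q) * X * N (X * g)
      - (X ^ 2 + Polynomial.C (2 * ka Q + ka Q ^ 2)) * N g - Polynomial.C (ka Q) * X * g) :
    ∀ n : ℕ, N (QQ Q (n + 1)) = Polynomial.C (kk Q ((n : ℤ) + 1)) * QQ Q n := by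
  have NC : ∀ (a : ℂ) (g : ℂ[X]), N (Polynomial.C a * g) = Polynomial.C a * N g := by
    intro a g
    rw [← Polynomial.smul_eq_C_mul, map_smul, Polynomial.smul_eq_C_mul]
  intro n
  induction n using Nat.strong_induction_on with
  | _ n ih =>
  have key := fun (g : ℂ[X]) => hN g
  match n, ih with
  | 0, ih => simp [QQ0, QQ1, NX, kk1 Q h1 h0]
  | 1, ih =>
    have e := hN 1
    have i1 := congrArg Polynomial.C (id1 Q h0 h1 0)
    have q2 := QQr Q 0
    have r2 : QQ Q 2 = X ^ 2 * 1 - Polynomial.C (cc Q 1) * 1 := by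
      rw [q2]; simp [QQ0, QQ1]; ring
    simp only [zero_add, kk0, kk1 Q h1 h0, map_sub, map_add, map_mul, map_zero] at i1
    rw [r2, map_sub, NC, N1, e]
    norm_num
    simp only [QQ1, NX, N1]
    norm_num at i1
    linear_combination X * i1
  | 2, ih =>
    have e := hN X
    have hh := ih 1 (by norm_num)
    have i1 := congrArg Polynomial.C (id1 Q h0 h1 1)
    have i2 := congrArg Polynomial.C (id2 Q h0 h1 1)
    have q2 : QQ Q 2 = X * X - Polynomial.C (cc Q 1) := by
      have := QQr Q 0
      simpa [QQ0, QQ1] using this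
    have q3 : QQ Q 3 = X * QQ Q 2 - Polynomial.C (cc Q 2) * X := by
      have := QQr Q 1
      norm_num [QQ0, QQ1] at this
      exact this
    have r3 : QQ Q 3 = X ^ 2 * X - Polynomial.C (cc Q 1 + cc Q 2) * X := by
      rw [q3, q2, map_add]; ring
    have rxx : X * X = QQ Q 2 + Polynomial.C (cc Q 1) * 1 := by rw [q2]; ring
    have nxx : N (X * X) = Polynomial.C (kk Q 2) * X := by
      rw [rxx, map_add, NC, N1]
      norm_num [QQ1] at hh
      rw [hh]; ring
    norm_num [cc0, kk0, kk1 Q h1 h0, map_sub, map_add, map_mul, map_zero] at i1 i2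
    rw [r3, map_sub, NC, NX, e, nxx, NX, q2]
    norm_num [map_add, map_mul]
    linear_combination (X * X - Polynomial.C (cc Q 1)) * i1 + i2
  | 3, ih =>
    have e := hN (QQ Q 2)
    have i1 := congrArg Polynomial.C (id1 Q h0 h1 2)
    have i2 := congrArg Polynomial.C (id2 Q h0 h1 2)
    have a1 := ih 1 (by norm_num)
    have a2 := ih 2 (by norm_num)
    have q2 : QQ Q 2 = X * X - Polynomial.C (cc Q 1) := by
      have := QQr Q 0
      simpa [QQ0, QQ1] using this
    have q3 : QQ Q 3 = X * QQ Q 2 - Polynomial.C (cc Q 2) * X := by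
      have := QQr Q 1
      norm_num [QQ0, QQ1] at this
      exact this
    have q4 : QQ Q 4 = X * QQ Q 3 - Polynomial.C (cc Q 3) * QQ Q 2 := by
      have := QQr Q 2
      norm_num at this
      exact this
    have r4 : QQ Q 4 = X ^ 2 * QQ Q 2 - Polynomial.C (cc Q 2 + cc Q 3) * QQ Q 2
        - Polynomial.C (cc Q 2 * cc Q 1) * 1 := by
      rw [q4, q3, map_add, map_mul, q2]; ring
    have r3 : X * QQ Q 2 = QQ Q 3 + Polynomial.C (cc Q 2) * X := by rw [q3]; ring
    norm_num [QQ1] at a1 a2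
    rw [r3, map_add N, NC, NX, a2, a1] at e
    norm_num [cc0, kk0, kk1 Q h1 h0, map_sub, map_add, map_mul, map_zero] at i1 i2 e
    rw [r4, map_sub, map_sub, NC, NC, N1, e, a1, q3, q2]
    norm_num [map_add, map_mul]
    linear_combination (X * (X * X - Polynomial.C (cc Q 1)) - Polynomial.C (cc Q 2) * X) * i1
      + X * i2
  | (m + 4), ih =>
    have e := hN (QQ Q (m + 3))
    have i1 := congrArg Polynomial.C (id1 Q h0 h1 (m + 3))
    have i2 := congrArg Polynomial.C (id2 Q h0 h1 (m + 3))
    have i3 := congrArg Polynomial.C (id3 Q h0 h1 (m + 3))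
    have a0 := ih m (by omega)
    have a2 := ih (m + 2) (by omega)
    have a1 := ih (m + 1) (by omega)
    have a3 := ih (m + 3) (by omega)
    have q2 := QQr Q m
    have q3 := QQr Q (m + 1)
    have q4 := QQr Q (m + 2)
    have q5 := QQr Q (m + 3)
    simp only [add_assoc] at q2 q3 q4 q5 a1 a2 a3 e i1 i2 i3 ⊢
    push_cast at q2 q3 q4 q5 a0 a1 a2 a3 i1 i2 i3 ⊢
    have s1 : ((m : ℤ) + 3 - 1) = m + 2 := by ring
    have s2 : ((m : ℤ) + 3 - 2) = m + 1 := by ring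
    rw [s1] at i2 i3
    rw [s2] at i3
    norm_num [add_assoc] at q2 q3 q4 q5 a0 a1 a2 a3 i1 i2 i3 e ⊢
    have r5 : QQ Q (m + 5) = X ^ 2 * QQ Q (m + 3)
        - Polynomial.C (cc Q (m + 4) + cc Q (m + 3)) * QQ Q (m + 3)
        - Polynomial.C (cc Q (m + 3) * cc Q (m + 2)) * QQ Q (m + 1) := by
      rw [q5, q4, map_add, map_mul]
      linear_combination (Polynomial.C (cc Q (m + 3))) * q3
    have r4 : X * QQ Q (m + 3) = QQ Q (m + 4) + Polynomial.C (cc Q (m + 3)) * QQ Q (m + 2) := by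
      rw [q4]; ring
    rw [r4, map_add N, NC, a3, a1, a2] at e
    rw [r5, map_sub, map_sub, NC, NC, e, a0, a2]
    simp only [map_add, map_mul]
    rw [q4, q3, q2]
    linear_combination (X * (X * (X * QQ Q (m + 1) - Polynomial.C (cc Q (m + 1)) * QQ Q m)
        - Polynomial.C (cc Q (m + 2)) * QQ Q (m + 1)) - Polynomial.C (cc Q (m + 3)) *
        (X * QQ Q (m + 1) - Polynomial.C (cc Q (m + 1)) * QQ Q m)) * i1
      + (X * QQ Q (m + 1) - Polynomial.C (cc Q (m + 1)) * QQ Q m) * i2 + QQ Q m * i3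

lemma sq1 {a : ℂ} (e : a ^ 2 = 1) : a = 1 ∨ a = -1 := by
  have : (a - 1) * (a + 1) = 0 := by linear_combination e
  rcases mul_eq_zero.mp this with h | h
  · left; linear_combination h
  · right; linear_combination h

lemma poly_ext (h : ℂ) (h0 : h ≠ 0) (p r : ℂ[X])
    (H : ∀ w : ℂ, w ≠ 0 → w ^ 2 ≠ 1 → (h * w) ^ 2 ≠ 1 → (h⁻¹ * w) ^ 2 ≠ 1 →
      p.eval ((w + w⁻¹) / 2) = r.eval ((w + w⁻¹) / 2)) : p = r := by
  apply Polynomial.eq_of_infinite_eval_eq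
  have hf : ({1, -1, (h + h⁻¹) / 2, -((h + h⁻¹) / 2)} : Set ℂ).Finite := by
    simp
  refine hf.infinite_compl.mono ?_
  intro x hx
  simp only [Set.mem_compl_iff, Set.mem_insert_iff, Set.mem_singleton_iff, not_or] at hx
  obtain ⟨x1, x2, x3, x4⟩ := hx
  obtain ⟨t, ht⟩ := IsAlgClosed.exists_pow_nat_eq (x ^ 2 - 1) (n := 2) (by norm_num)
  have hm : (x + t) * (x - t) = 1 := by linear_combination -ht
  have hw : x + t ≠ 0 := left_ne_zero_of_mul_eq_one hm
  have hi : (x + t)⁻¹ = x - t := inv_eq_of_mul_eq_one_right hm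
  have hx' : ((x + t) + (x + t)⁻¹) / 2 = x := by rw [hi]; ring
  have := H (x + t) hw ?_ ?_ ?_
  · rw [hx'] at this
    exact this
  · intro e
    rcases sq1 e with e | e <;> rw [e] at hx' <;> norm_num at hx'
    · exact x1 hx'.symm
    · exact x2 hx'.symm
  · intro e
    rcases sq1 e with e | e
    · have : x + t = h⁻¹ := by rw [eq_comm]; exact inv_eq_of_mul_eq_one_right e
      rw [this, inv_inv] at hx'
      exact x3 (by rw [← hx']; ring)
    · have : x + t = -h⁻¹ := by field_simp; linear_combination e
      rw [this, inv_neg, inv_inv] at hx'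
      exact x4 (by rw [← hx']; ring)
  · intro e
    rcases sq1 e with e | e
    · have : x + t = h := by field_simp at e; exact e
      rw [this] at hx'
      exact x3 (by rw [← hx'])
    · have : x + t = -h := by field_simp at e; linear_combination e
      rw [this, inv_neg] at hx'
      exact x4 (by rw [← hx']; ring)

lemma N_eval (q : ℝ) (h0 : qh q ≠ 0)
    (Dq Sq : ℂ[X] → ℂ[X]) (hD : IsAW q Dq) (hS : IsAv q Sq) (w : ℂ) (hw : w ≠ 0)
    (w1 : w ^ 2 ≠ 1) (w2 : (qh q * w) ^ 2 ≠ 1) (w3 : ((qh q)⁻¹ * w) ^ 2 ≠ 1) (g : ℂ[X]) :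
    (Sq (Dq g)).eval ((w + w⁻¹) / 2) =
     ((g.eval (((qh q) ^ 2 * w + ((qh q) ^ 2)⁻¹ * w⁻¹) / 2) - g.eval ((w + w⁻¹) / 2)) /
        (((qh q - (qh q)⁻¹) / 2) * (qh q * w - (qh q * w)⁻¹)) +
      (g.eval ((w + w⁻¹) / 2) - g.eval ((((qh q) ^ 2)⁻¹ * w + (qh q) ^ 2 * w⁻¹) / 2)) /
        (((qh q - (qh q)⁻¹) / 2) * ((qh q)⁻¹ * w - ((qh q)⁻¹ * w)⁻¹))) / 2 := by
  rw [hS _ w hw w1]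
  have e1 := hD g (qh q * w) (mul_ne_zero h0 hw) w2
  have e2 := hD g ((qh q)⁻¹ * w) (mul_ne_zero (inv_ne_zero h0) hw) w3
  have f1 : qh q * w + (qh q)⁻¹ * w⁻¹ = qh q * w + (qh q * w)⁻¹ := by rw [mul_inv]
  have f2 : (qh q)⁻¹ * w + qh q * w⁻¹ = (qh q)⁻¹ * w + ((qh q)⁻¹ * w)⁻¹ := by
    rw [mul_inv, inv_inv]
  rw [f1, f2, e1, e2]
  have g1 : qh q * (qh q * w) + (qh q)⁻¹ * (qh q * w)⁻¹
      = (qh q) ^ 2 * w + ((qh q) ^ 2)⁻¹ * w⁻¹ := by field_simp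
  have g2 : (qh q)⁻¹ * (qh q * w) + qh q * (qh q * w)⁻¹ = w + w⁻¹ := by field_simp
  have g3 : qh q * ((qh q)⁻¹ * w) + (qh q)⁻¹ * ((qh q)⁻¹ * w)⁻¹ = w + w⁻¹ := by field_simp
  have g4 : (qh q)⁻¹ * ((qh q)⁻¹ * w) + qh q * ((qh q)⁻¹ * w)⁻¹
      = ((qh q) ^ 2)⁻¹ * w + (qh q) ^ 2 * w⁻¹ := by field_simp
  rw [g1, g2, g3, g4]

lemma N_exists (q : ℝ) (h0 : qh q ≠ 0) (h1 : (qh q) ^ 2 - 1 ≠ 0)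
    (Dq Sq : ℂ[X] → ℂ[X]) (hD : IsAW q Dq) (hS : IsAv q Sq) :
    ∃ N : ℂ[X] →ₗ[ℂ] ℂ[X], (∀ g, N g = Sq (Dq g)) ∧ N 1 = 0 ∧ N X = 1 ∧
    (∀ g, N (X ^ 2 * g) = Polynomial.C (2 + 2 * ka ((qh q) ^ 2)) * X * N (X * g)
      - (X ^ 2 + Polynomial.C (2 * ka ((qh q) ^ 2) + ka ((qh q) ^ 2) ^ 2)) * N g
      - Polynomial.C (ka ((qh q) ^ 2)) * X * g) := by
  have ev := N_eval q h0 Dq Sq hD hS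
  refine ⟨{ toFun := fun g => Sq (Dq g), map_add' := ?_, map_smul' := ?_ },
    fun g => rfl, ?_, ?_, ?_⟩
  · intro f g
    apply poly_ext (qh q) h0
    intro w hw w1 w2 w3
    simp only [eval_add, ev w hw w1 w2 w3]
    ring
  · intro a g
    apply poly_ext (qh q) h0
    intro w hw w1 w2 w3
    simp only [eval_smul, smul_eq_mul, ev w hw w1 w2 w3, RingHom.id_apply]
    ring
  · apply poly_ext (qh q) h0
    intro w hw w1 w2 w3
    change (Sq (Dq 1)).eval _ = _
    simp [ev w hw w1 w2 w3]
  · apply poly_ext (qh q) h0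
    intro w hw w1 w2 w3
    change (Sq (Dq X)).eval _ = _
    rw [ev w hw w1 w2 w3]
    have d1 : qh q ^ 2 * w ^ 2 - 1 ≠ 0 := by rw [← mul_pow]; exact sub_ne_zero.mpr w2
    have d2 : w ^ 2 - (qh q) ^ 2 ≠ 0 := by
      intro e
      apply w3
      field_simp
      linear_combination e
    simp only [eval_X, eval_one]
    generalize qh q = h at *
    have e1 : h - h⁻¹ = (h ^ 2 - 1) / h := by field_simp
    have e2 : h * w - (h * w)⁻¹ = (h ^ 2 * w ^ 2 - 1) / (h * w) := by field_simp
    have e3 : h⁻¹ * w - (h⁻¹ * w)⁻¹ = (w ^ 2 - h ^ 2) / (h * w) := by field_simp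
    rw [e1, e2, e3]
    field_simp
    ring
  · intro g
    apply poly_ext (qh q) h0
    intro w hw w1 w2 w3
    change (Sq (Dq (X ^ 2 * g))).eval _ = (Polynomial.C (2 + 2 * ka ((qh q) ^ 2)) * X
      * Sq (Dq (X * g))
      - (X ^ 2 + Polynomial.C (2 * ka ((qh q) ^ 2) + ka ((qh q) ^ 2) ^ 2)) * Sq (Dq g)
      - Polynomial.C (ka ((qh q) ^ 2)) * X * g).eval _
    have d1 : qh q ^ 2 * w ^ 2 - 1 ≠ 0 := by rw [← mul_pow]; exact sub_ne_zero.mpr w2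
    have d2 : w ^ 2 - (qh q) ^ 2 ≠ 0 := by
      intro e
      apply w3
      field_simp
      linear_combination e
    simp only [eval_sub, eval_mul, eval_add, eval_pow, eval_C, eval_X, ev w hw w1 w2 w3]
    generalize g.eval ((w + w⁻¹) / 2) = G0
    generalize g.eval (((qh q) ^ 2 * w + ((qh q) ^ 2)⁻¹ * w⁻¹) / 2) = G1
    generalize g.eval ((((qh q) ^ 2)⁻¹ * w + (qh q) ^ 2 * w⁻¹) / 2) = G2
    generalize qh q = h at *
    have e1 : h - h⁻¹ = (h ^ 2 - 1) / h := by field_simp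
    have e2 : h * w - (h * w)⁻¹ = (h ^ 2 * w ^ 2 - 1) / (h * w) := by field_simp
    have e3 : h⁻¹ * w - (h⁻¹ * w)⁻¹ = (w ^ 2 - h ^ 2) / (h * w) := by field_simp
    rw [e1, e2, e3]
    simp only [ka]
    field_simp
    ring

lemma u_zero (Q : ℂ) (h0 : Q ≠ 0) (h1 : Q - 1 ≠ 0) (N : ℂ[X] →ₗ[ℂ] ℂ[X])
    (N1 : N 1 = 0)
    (hA : ∀ n : ℕ, N (QQ Q (n + 1)) = Polynomial.C (kk Q ((n : ℤ) + 1)) * QQ Q n)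
    (u : ℂ[X] →ₗ[ℂ] ℂ) (hu : ∀ f, (Q - 1) * (-(u (N f))) = 2 * u (X * f)) :
    ∀ n : ℕ, u (QQ Q (n + 1)) = 0 := by
  have uC : ∀ (a : ℂ) (g : ℂ[X]), u (Polynomial.C a * g) = a * u g := by
    intro a g
    rw [← Polynomial.smul_eq_C_mul, map_smul, smul_eq_mul]
  have hx : u X = 0 := by
    have := hu 1
    rw [N1] at this
    simpa using this.symm
  have step : ∀ n : ℕ, u (QQ Q (n + 2)) =
      ((1 - Q) / 2 * kk Q ((n : ℤ) + 1) - cc Q ((n : ℤ) + 1)) * u (QQ Q n) := by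
    intro n
    have := hu (QQ Q (n + 1))
    rw [hA, uC] at this
    rw [QQr, map_sub, uC]
    linear_combination (-1 / 2) * this
  intro n
  induction n using Nat.strong_induction_on with
  | _ n ih =>
  match n, ih with
  | 0, ih => rw [QQ1]; exact hx
  | 1, ih =>
    rw [step 0]
    simp [kk1 Q h1 h0, cc1 Q h0]
  | (m + 2), ih =>
    have := step (m + 1)
    rw [ih m (by omega), mul_zero] at this
    exact this

lemma u_orth (Q : ℂ) (u : ℂ[X] →ₗ[ℂ] ℂ) (hz : ∀ n : ℕ, u (QQ Q (n + 1)) = 0) :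
    ∀ m n : ℕ, m < n → u (QQ Q m * QQ Q n) = 0 := by
  have uC : ∀ (a : ℂ) (g : ℂ[X]), u (Polynomial.C a * g) = a * u g := by
    intro a g
    rw [← Polynomial.smul_eq_C_mul, map_smul, smul_eq_mul]
  intro m
  induction m using Nat.strong_induction_on with
  | _ m ih =>
  intro n hmn
  match m, ih, hmn with
  | 0, ih, hmn =>
    obtain ⟨k, rfl⟩ : ∃ k, n = k + 1 := ⟨n - 1, by omega⟩
    rw [QQ0, one_mul, hz]
  | 1, ih, hmn =>
    obtain ⟨k, rfl⟩ : ∃ k, n = k + 2 := ⟨n - 2, by omega⟩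
    have e : QQ Q 1 * QQ Q (k + 2) = QQ Q (k + 2 + 1)
        + Polynomial.C (cc Q (((k + 1 : ℕ) : ℤ) + 1)) * QQ Q (k + 1) := by
      rw [QQ1, QQr Q (k + 1)]; ring
    rw [e, map_add, uC, hz, hz]; ring
  | (l + 2), ih, hmn =>
    obtain ⟨k, rfl⟩ : ∃ k, n = k + 1 := ⟨n - 1, by omega⟩
    have e : QQ Q (l + 2) * QQ Q (k + 1) = QQ Q (l + 1) * QQ Q (k + 2)
        + Polynomial.C (cc Q ((k : ℤ) + 1)) * (QQ Q (l + 1) * QQ Q k)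
        - Polynomial.C (cc Q ((l : ℤ) + 1)) * (QQ Q l * QQ Q (k + 1)) := by
      rw [QQr Q l, QQr Q k]; ring
    rw [e, map_sub, map_add, uC, uC, ih (l + 1) (by omega) _ (by omega),
      ih (l + 1) (by omega) _ (by omega), ih l (by omega) _ (by omega)]
    ring

lemma ident (Q : ℂ) (u : ℂ[X] →ₗ[ℂ] ℂ) (hz : ∀ n : ℕ, u (QQ Q (n + 1)) = 0)
    (P : ℕ → ℂ[X]) (B Co : ℕ → ℂ) (hops : MonicOPS P B Co)
    (horth : ∀ m n : ℕ, m ≠ n → u (P m * P n) = 0)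
    (hreg : ∀ n : ℕ, u (P n ^ 2) ≠ 0) :
    ∀ n : ℕ, P n = QQ Q n ∧ P (n + 1) = QQ Q (n + 1) ∧ B n = 0 ∧
      (∀ k : ℕ, n = k + 1 → Co n = cc Q n) := by
  have uC : ∀ (a : ℂ) (g : ℂ[X]), u (Polynomial.C a * g) = a * u g := by
    intro a g
    rw [← Polynomial.smul_eq_C_mul, map_smul, smul_eq_mul]
  have ho := u_orth Q u hz
  intro n
  induction n with
  | zero =>
    have h := horth 0 1 (by norm_num)
    have hr := hreg 0
    have hb : B 0 = 0 := by
      rw [hops.p0] at hr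
      rw [hops.p0, hops.p1, one_mul, map_sub, ← mul_one (Polynomial.C (B 0)), uC, ← QQ1 Q,
        hz 0, zero_sub, neg_eq_zero, mul_eq_zero] at h
      rw [one_pow] at hr
      tauto
    refine ⟨by rw [hops.p0, QQ0], by rw [zero_add, hops.p1, hb, QQ1]; simp, hb, ?_⟩
    intro k hk
    omega
  | succ n ih =>
    obtain ⟨p0, p1, -, -⟩ := ih
    have e : P (n + 2) = QQ Q (n + 2) - Polynomial.C (B (n + 1)) * QQ Q (n + 1)
        + Polynomial.C (cc Q ((n : ℤ) + 1) - Co (n + 1)) * QQ Q n := by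
      rw [hops.ttrr, p0, p1, QQr, map_sub]; ring
    have o1 := horth (n + 1) (n + 2) (by omega)
    have o0 := horth n (n + 2) (by omega)
    have r0 := hreg n
    have r1 := hreg (n + 1)
    rw [p0] at o0 r0
    rw [p1] at o1 r1
    have hb : B (n + 1) = 0 := by
      have e' : QQ Q (n + 1) * P (n + 2) = QQ Q (n + 1) * QQ Q (n + 2)
          - Polynomial.C (B (n + 1)) * QQ Q (n + 1) ^ 2
          + Polynomial.C (cc Q ((n : ℤ) + 1) - Co (n + 1)) * (QQ Q n * QQ Q (n + 1)) := by
        rw [e]; ring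
      rw [e', map_add, map_sub, uC, uC, ho _ _ (by omega), ho _ _ (by omega), mul_zero,
        add_zero, zero_sub, neg_eq_zero, mul_eq_zero] at o1
      tauto
    have hc : cc Q ((n : ℤ) + 1) - Co (n + 1) = 0 := by
      have e' : QQ Q n * P (n + 2) = QQ Q n * QQ Q (n + 2)
          - Polynomial.C (B (n + 1)) * (QQ Q n * QQ Q (n + 1))
          + Polynomial.C (cc Q ((n : ℤ) + 1) - Co (n + 1)) * (QQ Q n ^ 2) := by
        rw [e]; ring
      rw [e', map_add, map_sub, uC, uC, ho _ _ (by omega), ho _ _ (by omega), mul_zero,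
        sub_zero, zero_add, mul_eq_zero] at o0
      tauto
    refine ⟨p1, ?_, hb, ?_⟩
    · change P (n + 2) = _
      rw [e, hb, hc]; simp
    · intro k _
      push_cast
      exact (sub_eq_zero.mp hc).symm

lemma ka_inv (Q : ℂ) : ka Q⁻¹ = ka Q := by
  simp only [ka, inv_inv]; ring

lemma kk_inv (Q : ℂ) (h0 : Q ≠ 0) (h1 : Q - 1 ≠ 0) (n : ℤ) : kk Q⁻¹ n = kk Q n := by
  have ht : Q ^ n ≠ 0 := zpow_ne_zero _ h0
  simp only [kk, inv_zpow]
  generalize Q ^ n = t at *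
  have : Q⁻¹ - 1 = -(Q - 1) / Q := by field_simp; ring
  rw [this]
  field_simp
  ring

lemma kk_eq (q : ℝ) (h0 : qh q ≠ 0) (h1 : (qh q) ^ 2 - 1 ≠ 0) (n : ℤ) :
    gamn q (n + 1) * alpn q n = kk ((qh q) ^ 2) (n + 1) := by
  have ht : (qh q) ^ n ≠ 0 := zpow_ne_zero _ h0
  have e : ((qh q) ^ 2) ^ n = ((qh q) ^ n) ^ 2 := by
    rw [← zpow_natCast, ← zpow_natCast, ← zpow_mul, ← zpow_mul, mul_comm]
  simp only [gamn, alpn, kk, zpow_neg, zpow_add₀ h0, zpow_add₀ (pow_ne_zero 2 h0), zpow_one, e]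
  generalize (qh q) ^ n = t at *
  generalize qh q = h at *
  have e1 : h - h⁻¹ = (h ^ 2 - 1) / h := by field_simp
  rw [e1]
  field_simp
  ring

lemma cc_eq (Q : ℂ) (h0 : Q ≠ 0) (n : ℤ) :
    cc Q (n + 1) = (1 - Q ^ (n + 1)) * (1 + Q ^ n) / 4 := by
  simp only [cc, zpow_add₀ h0, zpow_one]
  field_simp
end

end Helper10

/-- if a regular functional `u` with monic OPS `(P_n)` satisfies the four
functional equations (for some `s = ±1`), then `B_n = 0`,
`C_{n+1} = (1/4)(1 − q^{s(n+1)})(1 + q^{sn})`, i.e. `P_n = Q_n(z; s, −s | q^s)`,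
and `𝒮_q(𝒟_q P_n) = γ_n α_{n−1} P_{n−1}` for all `n ≥ 1`. -/
theorem stmt_10 (q : ℝ) (hq0 : 0 < q) (hq1 : q < 1)
    (Dq Sq : ℂ[X] → ℂ[X]) (hD : IsAW q Dq) (hS : IsAv q Sq)
    (u : ℂ[X] →ₗ[ℂ] ℂ) (P : ℕ → ℂ[X]) (B Co : ℕ → ℂ)
    (hops : MonicOPS P B Co)
    (horth : ∀ m n : ℕ, m ≠ n → u (P m * P n) = 0)
    (hreg : ∀ n : ℕ, u (P n ^ 2) ≠ 0)
    (s : ℤ) (hs : s = 1 ∨ s = -1)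
    (heq1 : ∀ f : ℂ[X],
      ((q : ℂ) ^ s - 1) * (-(u (Sq (Dq f)))) = 2 * u (X * f))
    (heq2 : ∀ f : ℂ[X],
      2 * (qh q) ^ (3 * s) * u (U2 q * Dq (Dq f)) =
        -(u ((2 * X ^ 2 + Polynomial.C ((q : ℂ) ^ s - 1)) * f)))
    (heq3 : ∀ f : ℂ[X],
      2 * (q : ℂ) ^ s * u (Sq (Sq f)) =
        u ((-(2 : ℂ[X]) * X ^ 2 + Polynomial.C (1 + (q : ℂ) ^ s)) * f))
    (heq4 : ∀ f : ℂ[X],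
      8 * (qh q) ^ (5 * s) * (-(u (U2 q * Dq (Sq f)))) =
        u ((Polynomial.C (1 - (q : ℂ) ^ s) * X *
          (-(4 : ℂ[X]) * X ^ 2 + Polynomial.C ((q : ℂ) ^ (2 * s) + 3))) * f)) :
    (∀ n : ℕ, B n = 0) ∧
    (∀ n : ℕ, Co (n + 1) =
      (1 - (q : ℂ) ^ (s * ((n : ℤ) + 1))) * (1 + (q : ℂ) ^ (s * n)) / 4) ∧
    (∀ n : ℕ, Sq (Dq (P (n + 1))) =
      Polynomial.C (gamn q ((n : ℤ) + 1) * alpn q n) * P n) := by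
  have hsq : qh q ^ 2 = (q : ℂ) := by
    rw [qh, ← Complex.ofReal_pow, Real.sq_sqrt hq0.le]
  have hq : (q : ℂ) ≠ 0 := by exact_mod_cast hq0.ne'
  have h0 : qh q ≠ 0 := by
    intro e
    rw [e] at hsq
    apply hq
    rw [← hsq]; simp
  have hq1' : (q : ℂ) - 1 ≠ 0 := by
    rw [sub_ne_zero]
    exact_mod_cast hq1.ne
  have h1 : qh q ^ 2 - 1 ≠ 0 := by rw [hsq]; exact hq1'
  obtain ⟨N, hN, N1, NX, hr⟩ := Helper10.N_exists q h0 h1 Dq Sq hD hS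
  rw [hsq] at hr
  have Q0 : (q : ℂ) ^ s ≠ 0 := zpow_ne_zero _ hq
  have Q1 : (q : ℂ) ^ s - 1 ≠ 0 := by
    rcases hs with rfl | rfl
    · simpa using hq1'
    · rw [zpow_neg_one, sub_ne_zero]
      intro e
      rw [inv_eq_one] at e
      exact hq1' (by rw [e]; ring)
  have kas : Helper10.ka ((q : ℂ) ^ s) = Helper10.ka q := by
    rcases hs with rfl | rfl
    · simp
    · rw [zpow_neg_one, Helper10.ka_inv]
  have kks : ∀ n, Helper10.kk ((q : ℂ) ^ s) n = Helper10.kk q n := by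
    intro n
    rcases hs with rfl | rfl
    · simp
    · rw [zpow_neg_one, Helper10.kk_inv _ hq hq1']
  rw [← kas] at hr
  have hA := Helper10.appell _ Q0 Q1 N N1 NX hr
  have hz := Helper10.u_zero _ Q0 Q1 N N1 hA u (fun f => by rw [hN]; exact heq1 f)
  have hI := Helper10.ident _ u hz P B Co hops horth hreg
  refine ⟨fun n => (hI n).2.2.1, fun n => ?_, fun n => ?_⟩
  · rw [(hI (n + 1)).2.2.2 n rfl]
    push_cast
    rw [Helper10.cc_eq _ Q0, zpow_mul, zpow_mul]
  · rw [← hN, (hI n).2.1, (hI n).1, hA, kks, Helper10.kk_eq q h0 h1, hsq]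
end

section
/- Let u be a regular linear functional on ℂ[z], let s ∈ {1, −1}, and suppose u satisfies (q^s − 1)·𝐃_q(𝐒_q u) = 2·(z·u) and 2q^s·𝐒_q(𝐒_q u) = (−2z² + 1 + q^s)·u. Then u satisfies the Pearson-type equation (q^{1/2} − q^{−1/2})·𝐃_q((z² − 1)·u) = −2s·𝐒_q(z·u); that is, 𝐃_q(φ·u) = 𝐒_q(ψ·u) with φ(z) = (s/2)(q^{1/2} − q^{−1/2})(z² − 1) and ψ(z) = z. -/
open Polynomial

noncomputable section

/-- Chebyshev polynomials of the first kind, indexed by naturals. -/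
def tt : ℕ → ℂ[X]
  | 0 => 1
  | 1 => X
  | n + 2 => 2 * X * tt (n + 1) - tt n

/-- Chebyshev polynomials of the second kind, indexed by naturals. -/
def uu : ℕ → ℂ[X]
  | 0 => 1
  | 1 => 2 * X
  | n + 2 => 2 * X * uu (n + 1) - uu n

theorem tt_eval (w v : ℂ) (h : w * v = 1) (n : ℕ) :
    (tt n).eval ((w + v) / 2) = (w ^ n + v ^ n) / 2 := by
  induction n using Nat.twoStepInduction with
  | zero => simp [tt]
  | one => simp [tt]
  | more n h0 h1 =>
    simp only [tt, eval_sub, eval_mul, eval_X, h0, h1, eval_ofNat]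
    linear_combination (w ^ n + v ^ n) / 2 * h

theorem uu_eval (w v : ℂ) (h : w * v = 1) (n : ℕ) :
    (uu n).eval ((w + v) / 2) * (w - v) = w ^ (n + 1) - v ^ (n + 1) := by
  induction n using Nat.twoStepInduction with
  | zero => simp [uu]
  | one => simp [uu]; ring
  | more n h0 h1 =>
    simp only [uu, eval_sub, eval_mul, eval_X, eval_ofNat]
    linear_combination (w + v) * h1 - h0 + (w ^ (n + 1) - v ^ (n + 1)) * h

theorem uu_add_two (n : ℕ) : uu (n + 2) = 2 * tt (n + 2) + uu n := by
  induction n using Nat.twoStepInduction with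
  | zero => simp [uu, tt]; ring
  | one => simp [uu, tt]; ring
  | more n h0 h1 =>
    have e1 : uu (n + 2 + 2) = 2 * X * uu (n + 1 + 2) - uu (n + 2) := by rw [uu]
    have e2 : tt (n + 2 + 2) = 2 * X * tt (n + 1 + 2) - tt (n + 2) := by rw [tt]
    have e3 : uu (n + 2) = 2 * X * uu (n + 1) - uu n := by rw [uu]
    linear_combination e1 - 2 * e2 + 2 * X * h1 - h0 - e3

theorem sq_mul_uu (n : ℕ) : 2 * ((X ^ 2 - 1) * uu n) = tt (n + 2) - tt n := by
  induction n using Nat.twoStepInduction with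
  | zero => simp [uu, tt]; ring
  | one => simp [uu, tt]; ring
  | more n h0 h1 =>
    have e1 : uu (n + 2) = 2 * X * uu (n + 1) - uu n := by rw [uu]
    have e2 : tt (n + 2 + 2) = 2 * X * tt (n + 1 + 2) - tt (n + 2) := by rw [tt]
    have e3 : tt (n + 2) = 2 * X * tt (n + 1) - tt n := by rw [tt]
    linear_combination 2 * (X ^ 2 - 1) * e1 - e2 + 2 * X * h1 - h0 + e3

theorem X_mul_tt (n : ℕ) : 2 * (X * tt (n + 1)) = tt (n + 2) + tt n := by
  rw [tt]; ring

theorem tt_span (M : Submodule ℂ ℂ[X]) (h : ∀ n, tt n ∈ M) (f : ℂ[X]) : f ∈ M := by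
  have hle : Submodule.span ℂ (Set.range tt) ≤ M := by
    rw [Submodule.span_le]; rintro _ ⟨n, rfl⟩; exact h n
  apply hle
  have hX : ∀ g ∈ Submodule.span ℂ (Set.range tt), X * g ∈ Submodule.span ℂ (Set.range tt) := by
    intro g hg
    induction hg using Submodule.span_induction with
    | mem x hx =>
      obtain ⟨n, rfl⟩ := hx
      cases n with
      | zero => exact Submodule.subset_span ⟨1, by simp [tt]⟩
      | succ n =>
        have : X * tt (n + 1) = (1 / 2 : ℂ) • (tt (n + 2) + tt n) := by
          rw [← X_mul_tt, smul_eq_C_mul, ← mul_assoc,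
            show (2 : ℂ[X]) = C 2 from rfl, ← C_mul]
          norm_num
        rw [this]
        exact Submodule.smul_mem _ _ (Submodule.add_mem _ (Submodule.subset_span ⟨_, rfl⟩)
          (Submodule.subset_span ⟨_, rfl⟩))
    | zero => simp
    | add x y _ _ hx hy => rw [mul_add]; exact Submodule.add_mem _ hx hy
    | smul a x _ hx => rw [mul_smul_comm]; exact Submodule.smul_mem _ _ hx
  have hpow : ∀ n : ℕ, (X : ℂ[X]) ^ n ∈ Submodule.span ℂ (Set.range tt) := by
    intro n
    induction n with
    | zero => exact Submodule.subset_span ⟨0, by simp [tt]⟩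
    | succ n ih => rw [pow_succ']; exact hX _ ih
  induction f using Polynomial.induction_on' with
  | add p r hp hr => exact Submodule.add_mem _ hp hr
  | monomial n a =>
    rw [← smul_X_eq_monomial]; exact Submodule.smul_mem _ _ (hpow n)

theorem ext_joukowski (p r : ℂ[X])
    (h : ∀ w v : ℂ, w * v = 1 → w ≠ 0 → w ^ 2 ≠ 1 → w - v ≠ 0 →
      p.eval ((w + v) / 2) = r.eval ((w + v) / 2)) : p = r := by
  apply Polynomial.eq_of_infinite_eval_eq
  have hinf : (({1, -1} : Set ℂ)ᶜ).Infinite := (Set.toFinite _).infinite_compl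
  refine hinf.mono ?_
  intro z hz
  simp only [Set.mem_compl_iff, Set.mem_insert_iff, Set.mem_singleton_iff, not_or] at hz
  obtain ⟨y, hy⟩ := IsAlgClosed.exists_pow_nat_eq (z ^ 2 - 1) (n := 2) (by norm_num)
  have h1 : (z + y) * (z - y) = 1 := by linear_combination -hy
  have hy0 : y ≠ 0 := by
    rintro rfl
    have : (z - 1) * (z + 1) = 0 := by linear_combination -hy
    rcases mul_eq_zero.1 this with h | h
    · exact hz.1 (by linear_combination h)
    · exact hz.2 (by linear_combination h)
  have hw : z + y ≠ 0 := left_ne_zero_of_mul_eq_one h1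
  have := h (z + y) (z - y) h1 hw (by
    intro h2
    have : (z + y) * (2 * y) = 0 := by linear_combination h2 - h1
    rcases mul_eq_zero.1 this with h | h
    · exact hw h
    · exact hy0 (by linear_combination h / 2)) (by
    intro h2; exact hy0 (by linear_combination h2 / 2))
  have e : (z + y + (z - y)) / 2 = z := by ring
  rwa [e] at this

theorem core (b c : ℂ) (hbc : b * c = 1) (hne : b - c ≠ 0)
    (D S : ℂ[X] → ℂ[X])
    (hD : ∀ p : ℂ[X], ∀ w v : ℂ, w * v = 1 → w ≠ 0 → w ^ 2 ≠ 1 →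
      (D p).eval ((w + v) / 2) =
        (p.eval ((b * w + c * v) / 2) - p.eval ((c * w + b * v) / 2)) /
          (((b - c) / 2) * (w - v)))
    (hS : ∀ p : ℂ[X], ∀ w v : ℂ, w * v = 1 → w ≠ 0 → w ^ 2 ≠ 1 →
      (S p).eval ((w + v) / 2) =
        (p.eval ((b * w + c * v) / 2) + p.eval ((c * w + b * v) / 2)) / 2)
    (u : ℂ[X] →ₗ[ℂ] ℂ)
    (heq1 : ∀ f : ℂ[X], (b ^ 2 - 1) * (-(u (S (D f)))) = 2 * u (X * f)) (f : ℂ[X]) :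
    (b - c) * (-(u ((X ^ 2 - 1) * D f))) = -2 * u (X * S f) := by
  have Dadd : ∀ p r, D (p + r) = D p + D r := by
    intro p r
    apply ext_joukowski
    intro w v h h0 h1 h2
    simp only [eval_add, hD _ w v h h0 h1]
    ring
  have Sadd : ∀ p r, S (p + r) = S p + S r := by
    intro p r
    apply ext_joukowski
    intro w v h h0 h1 h2
    simp only [eval_add, hS _ w v h h0 h1]
    ring
  have Dsmul : ∀ (a : ℂ) p, D (a • p) = a • D p := by
    intro a p
    apply ext_joukowski
    intro w v h h0 h1 h2
    simp only [eval_smul, hD _ w v h h0 h1, smul_eq_mul]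
    ring
  have Ssmul : ∀ (a : ℂ) p, S (a • p) = a • S p := by
    intro a p
    apply ext_joukowski
    intro w v h h0 h1 h2
    simp only [eval_smul, hS _ w v h h0 h1, smul_eq_mul]
    ring
  have S0 : S 0 = 0 := by simpa using Ssmul 0 0
  have D0 : D 0 = 0 := by simpa using Dsmul 0 0
  have Dt0 : D (tt 0) = 0 := by
    apply ext_joukowski
    intro w v h h0 h1 h2
    simp [hD _ w v h h0 h1, tt]
  have key1 : ∀ w v : ℂ, w * v = 1 → (b * w) * (c * v) = 1 := by
    intro w v h; linear_combination w * v * hbc + h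
  have key2 : ∀ w v : ℂ, w * v = 1 → (c * w) * (b * v) = 1 := by
    intro w v h; linear_combination w * v * hbc + h
  have Dt : ∀ n, D (tt (n + 1)) = ((b ^ (n + 1) - c ^ (n + 1)) / (b - c)) • uu n := by
    intro n
    apply ext_joukowski
    intro w v h h0 h1 h2
    rw [hD _ w v h h0 h1, tt_eval _ _ (key1 w v h), tt_eval _ _ (key2 w v h), eval_smul,
      smul_eq_mul]
    have := uu_eval w v h n
    rw [← eq_div_iff h2] at this
    rw [this]
    field_simp
    ring
  have St : ∀ n, S (tt n) = ((b ^ n + c ^ n) / 2) • tt n := by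
    intro n
    apply ext_joukowski
    intro w v h h0 h1 h2
    rw [hS _ w v h h0 h1, tt_eval _ _ (key1 w v h), tt_eval _ _ (key2 w v h), eval_smul,
      smul_eq_mul, tt_eval w v h]
    ring
  have hbcn : ∀ n : ℕ, b ^ n * c ^ n = 1 := by
    intro n; rw [← mul_pow, hbc, one_pow]
  have two : ∀ p : ℂ[X], 2 * p = (2 : ℂ) • p := by
    intro p; rw [smul_eq_C_mul]; rfl
  have uX : ∀ n, 2 * u (X * tt (n + 1)) = u (tt (n + 2)) + u (tt n) := by
    intro n
    rw [← map_add, ← X_mul_tt, two, map_smul, smul_eq_mul]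
  have uD : ∀ n, 2 * u ((X ^ 2 - 1) * uu n) = u (tt (n + 2)) - u (tt n) := by
    intro n
    rw [← map_sub, ← sq_mul_uu, two, map_smul, smul_eq_mul]
  have t1 : u (tt 1) = 0 := by
    have := heq1 (tt 0)
    rw [Dt0, S0] at this
    simpa [tt] using this
  have rec0 : ∀ n, u (S (uu n)) = b ^ n * u (tt n) →
      u (tt (n + 2)) = - b ^ (2 * (n + 1)) * u (tt n) := by
    intro n hn
    have h := heq1 (tt (n + 1))
    rw [uX, Dt, Ssmul, map_smul, smul_eq_mul, hn] at h
    have e : (b ^ 2 - 1) * ((b ^ (n + 1) - c ^ (n + 1)) / (b - c)) =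
        b * (b ^ (n + 1) - c ^ (n + 1)) := by
      field_simp
      linear_combination (b ^ (n + 1) - c ^ (n + 1)) * hbc
    linear_combination -h - b ^ n * u (tt n) * e + u (tt n) * hbcn (n + 1)
  have H : ∀ n, u (S (uu n)) = b ^ n * u (tt n) := by
    intro n
    induction n using Nat.twoStepInduction with
    | zero =>
      have := St 0
      simp [tt] at this
      simp [uu, tt, this]
    | one =>
      have : uu 1 = (2 : ℂ) • tt 1 := by rw [← two]; simp [uu, tt]
      rw [this, Ssmul, St]
      simp [t1]
    | more n h0 h1 =>
      rw [uu_add_two, Sadd, two, Ssmul, St, map_add, map_smul, map_smul, smul_eq_mul,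
        smul_eq_mul, h0]
      have h2 := rec0 n h0
      rw [h2]
      linear_combination -(b ^ n * u (tt n)) * hbcn (n + 2)
  have R := fun n => rec0 n (H n)
  let M : Submodule ℂ ℂ[X] :=
    { carrier := {f | (b - c) * (-(u ((X ^ 2 - 1) * D f))) = -2 * u (X * S f)}
      zero_mem' := by simp [D0, S0]
      add_mem' := by
        intro p r hp hr
        simp only [Set.mem_ofPred_eq, Dadd, Sadd, mul_add, map_add] at *
        linear_combination hp + hr
      smul_mem' := by
        intro a p hp
        simp only [Set.mem_ofPred_eq, Dsmul, Ssmul, mul_smul_comm, map_smul, smul_eq_mul] at *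
        linear_combination a * hp }
  refine tt_span M ?_ f
  intro n
  change (b - c) * (-(u ((X ^ 2 - 1) * D (tt n)))) = -2 * u (X * S (tt n))
  cases n with
  | zero =>
    rw [Dt0, St]
    simpa [tt] using t1
  | succ n =>
    rw [Dt, St, mul_smul_comm, mul_smul_comm, map_smul, map_smul, smul_eq_mul, smul_eq_mul]
    have e : (b - c) * ((b ^ (n + 1) - c ^ (n + 1)) / (b - c)) = b ^ (n + 1) - c ^ (n + 1) := by
      field_simp
    linear_combination -(u ((X ^ 2 - 1) * uu n)) * e
      - (b ^ (n + 1) - c ^ (n + 1)) / 2 * uD n + (b ^ (n + 1) + c ^ (n + 1)) / 2 * uX n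
      + c ^ (n + 1) * R n - b ^ (n + 1) * u (tt n) * hbcn (n + 1)

end

/-- if a regular functional `u` satisfies
`(q^s − 1)·𝐃_q(𝐒_q u) = 2·(z·u)` and `2q^s·𝐒_q(𝐒_q u) = (−2z² + 1 + q^s)·u` for some
`s = ±1`, then `u` satisfies the Pearson-type equation
`(q^{1/2} − q^{−1/2})·𝐃_q((z² − 1)·u) = −2s·𝐒_q(z·u)`. -/
theorem stmt_11 (q : ℝ) (hq0 : 0 < q) (hq1 : q < 1)
    (Dq Sq : ℂ[X] → ℂ[X]) (hD : IsAW q Dq) (hS : IsAv q Sq)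
    (u : ℂ[X] →ₗ[ℂ] ℂ) (P : ℕ → ℂ[X])
    (hmonic : ∀ n, (P n).Monic) (hdeg : ∀ n, (P n).natDegree = n)
    (horth : ∀ m n : ℕ, m ≠ n → u (P m * P n) = 0)
    (hreg : ∀ n : ℕ, u (P n ^ 2) ≠ 0)
    (s : ℤ) (hs : s = 1 ∨ s = -1)
    (heq1 : ∀ f : ℂ[X],
      ((q : ℂ) ^ s - 1) * (-(u (Sq (Dq f)))) = 2 * u (X * f))
    (heq3 : ∀ f : ℂ[X],
      2 * (q : ℂ) ^ s * u (Sq (Sq f)) =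
        u ((-(2 : ℂ[X]) * X ^ 2 + Polynomial.C (1 + (q : ℂ) ^ s)) * f)) :
    ∀ f : ℂ[X],
      (qh q - (qh q)⁻¹) * (-(u ((X ^ 2 - 1) * Dq f))) =
        -2 * (s : ℂ) * u (X * Sq f) := by
  intro f
  have hsq : 0 < Real.sqrt q := Real.sqrt_pos.2 hq0
  have ha : qh q ≠ 0 := by
    unfold qh; exact_mod_cast hsq.ne'
  have ha2 : qh q ^ 2 = (q : ℂ) := by
    unfold qh; exact_mod_cast Real.sq_sqrt hq0.le
  have hac : qh q * (qh q)⁻¹ = 1 := mul_inv_cancel₀ ha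
  have hne : qh q - (qh q)⁻¹ ≠ 0 := by
    intro h
    have h1 : qh q ^ 2 = 1 := by linear_combination qh q * h + hac
    rw [ha2] at h1
    have : q = 1 := by exact_mod_cast h1
    linarith
  have hv : ∀ w v : ℂ, w * v = 1 → v = w⁻¹ := fun w v h => eq_inv_of_mul_eq_one_right h
  rcases hs with rfl | rfl
  · have := core (qh q) (qh q)⁻¹ hac hne Dq Sq
      (by intro p w v h h0 h1; rw [hv w v h]; exact hD p w h0 h1)
      (by intro p w v h h0 h1; rw [hv w v h]; exact hS p w h0 h1) u
      (by intro g; rw [ha2]; simpa using heq1 g) f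
    rw [this]; push_cast; ring
  · have := core (qh q)⁻¹ (qh q) (by rw [mul_comm]; exact hac)
      (by intro h; apply hne; linear_combination -h) Dq Sq
      (by
        intro p w v h h0 h1
        rw [hv w v h, hD p w h0 h1, ← neg_div_neg_eq]
        congr 1 <;> ring)
      (by intro p w v h h0 h1; rw [hv w v h, hS p w h0 h1]; ring) u
      (by intro g; rw [inv_pow, ha2]; simpa using heq1 g) f
    push_cast
    linear_combination -this
end

section
/- Let (P_n)_{n≥0} be a monic OPS with recurrence coefficients (B_n, C_n) satisfying 𝒟_q(𝒮_q P_n) = r_n P_{n−1} for all n ≥ 0, for some constants r_n ∈ ℂ. Then for every n ≥ 2: 2(α² − 1)·(z² − α²)·(𝒟_q(𝒟_q P_n)) = a_n P_n + b_n P_{n−1} + c_n P_{n−2}, where a_n = r_{n+1} − (4α² − 3)r_n − α, b_n = (B_n − (4α² − 3)B_{n−1})·r_n, and c_n = r_{n−1}C_n − (4α² − 3)r_n C_{n−1}. -/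
open Polynomial

/-- Pointwise value of `D (S p)`. -/
theorem aux_DS (q : ℝ) (Dq Sq : ℂ[X] → ℂ[X]) (hD : IsAW q Dq) (hS : IsAv q Sq)
    (h w : ℂ) (hh : qh q = h) (h0 : h ≠ 0) (w0 : w ≠ 0) (w1 : w ^ 2 ≠ 1)
    (w2 : (h * w) ^ 2 ≠ 1) (w3 : (h⁻¹ * w) ^ 2 ≠ 1) (p : ℂ[X]) :
    (Dq (Sq p)).eval ((w + w⁻¹) / 2) =
      (p.eval ((h ^ 2 * w + (h ^ 2 * w)⁻¹) / 2) - p.eval ((h⁻¹ ^ 2 * w + (h⁻¹ ^ 2 * w)⁻¹) / 2)) /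
        ((h - h⁻¹) * (w - w⁻¹)) := by
  have e1 := hS p (h * w) (mul_ne_zero h0 w0) w2
  have e2 := hS p (h⁻¹ * w) (mul_ne_zero (inv_ne_zero h0) w0) w3
  have e := hD (Sq p) w w0 w1
  rw [hh] at e e1 e2
  have a1 : h * w + h⁻¹ * w⁻¹ = h * w + (h * w)⁻¹ := by rw [mul_inv]
  have a2 : h⁻¹ * w + h * w⁻¹ = h⁻¹ * w + (h⁻¹ * w)⁻¹ := by rw [mul_inv, inv_inv]
  have b1 : h * (h * w) + h⁻¹ * (h * w)⁻¹ = h ^ 2 * w + (h ^ 2 * w)⁻¹ := by field_simp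
  have b2 : h⁻¹ * (h * w) + h * (h * w)⁻¹ = w + w⁻¹ := by field_simp
  have b3 : h * (h⁻¹ * w) + h⁻¹ * (h⁻¹ * w)⁻¹ = w + w⁻¹ := by field_simp
  have b4 : h⁻¹ * (h⁻¹ * w) + h * (h⁻¹ * w)⁻¹ = h⁻¹ ^ 2 * w + (h⁻¹ ^ 2 * w)⁻¹ := by field_simp
  rw [b1, b2] at e1
  rw [b3, b4] at e2
  rw [a1, a2, e1, e2] at e
  rw [e, div_mul_eq_mul_div, div_div_eq_mul_div]
  congr 1
  ring

/-- Pointwise value of `D (D p)`. -/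
theorem aux_DD (q : ℝ) (Dq : ℂ[X] → ℂ[X]) (hD : IsAW q Dq)
    (h w : ℂ) (hh : qh q = h) (h0 : h ≠ 0) (w0 : w ≠ 0) (w1 : w ^ 2 ≠ 1)
    (w2 : (h * w) ^ 2 ≠ 1) (w3 : (h⁻¹ * w) ^ 2 ≠ 1) (p : ℂ[X]) :
    (Dq (Dq p)).eval ((w + w⁻¹) / 2) =
      ((p.eval ((h ^ 2 * w + (h ^ 2 * w)⁻¹) / 2) - p.eval ((w + w⁻¹) / 2)) /
          (((h - h⁻¹) / 2) * (h * w - (h * w)⁻¹)) -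
        (p.eval ((w + w⁻¹) / 2) - p.eval ((h⁻¹ ^ 2 * w + (h⁻¹ ^ 2 * w)⁻¹) / 2)) /
          (((h - h⁻¹) / 2) * (h⁻¹ * w - (h⁻¹ * w)⁻¹))) /
        (((h - h⁻¹) / 2) * (w - w⁻¹)) := by
  have e1 := hD p (h * w) (mul_ne_zero h0 w0) w2
  have e2 := hD p (h⁻¹ * w) (mul_ne_zero (inv_ne_zero h0) w0) w3
  have e := hD (Dq p) w w0 w1
  rw [hh] at e e1 e2
  have a1 : h * w + h⁻¹ * w⁻¹ = h * w + (h * w)⁻¹ := by rw [mul_inv]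
  have a2 : h⁻¹ * w + h * w⁻¹ = h⁻¹ * w + (h⁻¹ * w)⁻¹ := by rw [mul_inv, inv_inv]
  have b1 : h * (h * w) + h⁻¹ * (h * w)⁻¹ = h ^ 2 * w + (h ^ 2 * w)⁻¹ := by field_simp
  have b2 : h⁻¹ * (h * w) + h * (h * w)⁻¹ = w + w⁻¹ := by field_simp
  have b3 : h * (h⁻¹ * w) + h⁻¹ * (h⁻¹ * w)⁻¹ = w + w⁻¹ := by field_simp
  have b4 : h⁻¹ * (h⁻¹ * w) + h * (h⁻¹ * w)⁻¹ = h⁻¹ ^ 2 * w + (h⁻¹ ^ 2 * w)⁻¹ := by field_simp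
  rw [b1, b2] at e1
  rw [b3, b4] at e2
  rw [a1, a2, e1, e2] at e
  exact e

/-- The algebraic identity behind the operator identity. -/
theorem aux_alg (h w Fp F0 Fm : ℂ) (h0 : h ≠ 0) (w0 : w ≠ 0) (h1 : h ^ 2 ≠ 1) (w1 : w ^ 2 ≠ 1)
    (w2 : (h * w) ^ 2 ≠ 1) (w3 : (h⁻¹ * w) ^ 2 ≠ 1) :
    2 * (((h + h⁻¹) / 2) ^ 2 - 1) * (((w + w⁻¹) / 2) ^ 2 - ((h + h⁻¹) / 2) ^ 2) *
      (((Fp - F0) / (((h - h⁻¹) / 2) * (h * w - (h * w)⁻¹)) -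
        (F0 - Fm) / (((h - h⁻¹) / 2) * (h⁻¹ * w - (h⁻¹ * w)⁻¹))) /
        (((h - h⁻¹) / 2) * (w - w⁻¹))) =
    ((h ^ 2 * w + (h ^ 2 * w)⁻¹) / 2 * Fp - (h⁻¹ ^ 2 * w + (h⁻¹ ^ 2 * w)⁻¹) / 2 * Fm) /
        ((h - h⁻¹) * (w - w⁻¹)) -
      (4 * ((h + h⁻¹) / 2) ^ 2 - 3) * ((w + w⁻¹) / 2) *
        ((Fp - Fm) / ((h - h⁻¹) * (w - w⁻¹))) - (h + h⁻¹) / 2 * F0 := by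
  have k1 : h ^ 2 - 1 ≠ 0 := sub_ne_zero.2 h1
  have k2 : w ^ 2 - 1 ≠ 0 := sub_ne_zero.2 w1
  have k3 : h ^ 2 * w ^ 2 - 1 ≠ 0 := by rw [← mul_pow]; exact sub_ne_zero.2 w2
  have k4 : w ^ 2 - h ^ 2 ≠ 0 := by
    intro e
    apply w3
    rw [mul_pow, sub_eq_zero.1 e]
    field_simp
  have d1 : h - h⁻¹ = (h ^ 2 - 1) / h := by field_simp
  have d2 : w - w⁻¹ = (w ^ 2 - 1) / w := by field_simp
  have d3 : h * w - (h * w)⁻¹ = (h ^ 2 * w ^ 2 - 1) / (h * w) := by field_simp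
  have d4 : h⁻¹ * w - (h⁻¹ * w)⁻¹ = (w ^ 2 - h ^ 2) / (h * w) := by field_simp
  rw [d1, d2, d3, d4]
  field_simp
  ring

/-- Two polynomials agreeing at `(w + 1/w)/2` for all large real `w` are equal. -/
theorem aux_ext (M : ℝ) (hM : 1 ≤ M) (f g : ℂ[X])
    (H : ∀ t : ℝ, M < t → f.eval (((t : ℂ) + (t : ℂ)⁻¹) / 2) = g.eval (((t : ℂ) + (t : ℂ)⁻¹) / 2)) :
    f = g := by
  apply Polynomial.eq_of_infinite_eval_eq
  have hi : Set.InjOn (fun t : ℝ => ((t : ℂ) + (t : ℂ)⁻¹) / 2) (Set.Ioi M) := by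
    intro a ha b hb hab
    have ha' : 1 < a := lt_of_le_of_lt hM ha
    have hb' : 1 < b := lt_of_le_of_lt hM hb
    have h2 : (a + a⁻¹) / 2 = (b + b⁻¹) / 2 := by
      have : (((a + a⁻¹) / 2 : ℝ) : ℂ) = (((b + b⁻¹) / 2 : ℝ) : ℂ) := by
        push_cast
        exact hab
      exact_mod_cast this
    have a0 : a ≠ 0 := by positivity
    have b0 : b ≠ 0 := by positivity
    field_simp at h2
    have h3 : (a - b) * (a * b - 1) = 0 := by linarith
    rcases mul_eq_zero.1 h3 with h4 | h4
    · linarith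
    · nlinarith
  apply ((Set.Ioi_infinite M).image hi).mono
  rintro _ ⟨t, ht, rfl⟩
  exact H t ht

/-- for a monic OPS with `𝒟_q(𝒮_q P_n) = r_n P_{n-1}`, for every `n ≥ 2`,
`2(α²−1)(z²−α²)·𝒟_q²P_n = a_n P_n + b_n P_{n−1} + c_n P_{n−2}`. -/
theorem stmt_12 (q : ℝ) (hq0 : 0 < q) (hq1 : q < 1)
    (Dq Sq : ℂ[X] → ℂ[X]) (hD : IsAW q Dq) (hS : IsAv q Sq)
    (P : ℕ → ℂ[X]) (B Co : ℕ → ℂ) (hops : MonicOPS P B Co)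
    (r : ℕ → ℂ) (hAp : AppellDS Dq Sq P r) :
    ∀ n : ℕ, 2 ≤ n →
      Polynomial.C (2 * ((alp q) ^ 2 - 1)) * (X ^ 2 - Polynomial.C ((alp q) ^ 2)) *
        Dq (Dq (P n)) =
        Polynomial.C (r (n + 1) - (4 * (alp q) ^ 2 - 3) * r n - alp q) * P n +
        Polynomial.C ((B n - (4 * (alp q) ^ 2 - 3) * B (n - 1)) * r n) * P (n - 1) +
        Polynomial.C (r (n - 1) * Co n - (4 * (alp q) ^ 2 - 3) * r n * Co (n - 1)) *
          P (n - 2) := by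
  intro n hn
  obtain ⟨m, rfl⟩ : ∃ m, n = m + 2 := ⟨n - 2, by omega⟩
  have i1 : m + 2 - 1 = m + 1 := rfl
  have i2 : m + 2 - 2 = m := rfl
  rw [i1, i2]
  have s0 : 0 < Real.sqrt q := Real.sqrt_pos.2 hq0
  have s1 : Real.sqrt q < 1 := by
    rw [Real.sqrt_lt' one_pos]; simpa using hq1
  obtain ⟨s, hs⟩ : ∃ s, s = Real.sqrt q := ⟨_, rfl⟩
  rw [← hs] at s0 s1
  have hh : qh q = (s : ℂ) := by rw [qh, hs]
  have hsi : 1 < s⁻¹ := (one_lt_inv₀ s0).2 s1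
  apply aux_ext s⁻¹ hsi.le
  intro t ht
  have t1 : 1 < t := hsi.trans ht
  have st1 : 1 < s * t := by
    have := mul_lt_mul_of_pos_left ht s0
    rwa [mul_inv_cancel₀ s0.ne'] at this
  have st2 : 1 < s⁻¹ * t := by nlinarith
  have h0 : (s : ℂ) ≠ 0 := by exact_mod_cast s0.ne'
  have w0 : (t : ℂ) ≠ 0 := by exact_mod_cast (by positivity : t ≠ 0)
  have h1 : (s : ℂ) ^ 2 ≠ 1 := by
    have : s ^ 2 ≠ 1 := by nlinarith
    exact_mod_cast this
  have w1 : (t : ℂ) ^ 2 ≠ 1 := by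
    have : t ^ 2 ≠ 1 := by nlinarith
    exact_mod_cast this
  have w2 : ((s : ℂ) * t) ^ 2 ≠ 1 := by
    have : (s * t) ^ 2 ≠ 1 := by nlinarith
    exact_mod_cast this
  have w3 : ((s : ℂ)⁻¹ * t) ^ 2 ≠ 1 := by
    have : (s⁻¹ * t) ^ 2 ≠ 1 := by nlinarith
    exact_mod_cast this
  have hal : alp q = ((s : ℂ) + (s : ℂ)⁻¹) / 2 := by rw [alp, hh]
  have DS := aux_DS q Dq Sq hD hS s t hh h0 w0 w1 w2 w3
  have DD := aux_DD q Dq hD s t hh h0 w0 w1 w2 w3 (P (m + 2))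
  have A3 := DS (P (m + 3))
  have A2 := DS (P (m + 2))
  have A1 := DS (P (m + 1))
  rw [hAp.2] at A1 A2 A3
  have R3 := hops.ttrr (m + 1)
  have R2 := hops.ttrr m
  have R2z := congrArg (Polynomial.eval (((t : ℂ) + (t : ℂ)⁻¹) / 2)) R2
  rw [show m + 1 + 2 = m + 3 from rfl, show m + 1 + 1 = m + 2 from rfl] at R3
  rw [R3] at A3
  have alg := fun Fp F0 Fm => aux_alg s t Fp F0 Fm h0 w0 h1 w1 w2 w3
  simp only [eval_add, eval_sub, eval_mul, eval_pow, eval_C, eval_X] at A1 A2 A3 R2z ⊢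
  rw [DD, hal, alg]
  generalize ((s : ℂ) - (s : ℂ)⁻¹) * ((t : ℂ) - (t : ℂ)⁻¹) = K at *
  generalize ((s : ℂ) ^ 2 * t + ((s : ℂ) ^ 2 * t)⁻¹) / 2 = xp at *
  generalize ((s : ℂ)⁻¹ ^ 2 * t + ((s : ℂ)⁻¹ ^ 2 * t)⁻¹) / 2 = xm at *
  generalize ((t : ℂ) + (t : ℂ)⁻¹) / 2 = z at *
  generalize ((s : ℂ) + (s : ℂ)⁻¹) / 2 = a at *
  linear_combination (-1) * A3 - B (m + 2) * A2 - Co (m + 2) * A1 +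
    (4 * a ^ 2 - 3) * z * A2 + (4 * a ^ 2 - 3) * r (m + 2) * R2z
end

section
/- Let (P_n)_{n≥0} be a monic OPS with recurrence coefficients (B_n, C_n) satisfying 𝒟_q(𝒮_q P_n) = r_n P_{n−1} for all n ≥ 0, for some constants r_n ∈ ℂ. Set t_n = r_n/C_n for n ≥ 1. Then for all n ≥ 1: r_{n+2} − 2(2α² − 1)r_{n+1} + r_n = 0, and t_{n+2} − 2(2α² − 1)t_{n+1} + t_n = 0. -/
open Polynomial

lemma aux_good (s : ℂ) (hs : s ≠ 0) (p : ℂ[X])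
    (h : ∀ w : ℂ, w ≠ 0 → w ^ 2 ≠ 1 → (s * w) ^ 2 ≠ 1 → (s⁻¹ * w) ^ 2 ≠ 1 →
      p.eval ((w + w⁻¹) / 2) = 0) : p = 0 := by
  classical
  let bad : Finset ℂ := ({1, -1, s, -s, s⁻¹, -s⁻¹} : Finset ℂ).image (fun w => (w + w⁻¹) / 2)
  apply Polynomial.eq_zero_of_infinite_isRoot
  refine Set.Infinite.mono ?_ (bad.finite_toSet.infinite_compl)
  intro x hx
  obtain ⟨y, hy⟩ := IsAlgClosed.exists_pow_nat_eq (x ^ 2 - 1) (n := 2) (by norm_num)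
  have hm : (x + y) * (x - y) = 1 := by linear_combination -hy
  have hne : x + y ≠ 0 := left_ne_zero_of_mul_eq_one hm
  have hinv : (x + y)⁻¹ = x - y := inv_eq_of_mul_eq_one_right hm
  have hxe : ((x + y) + (x + y)⁻¹) / 2 = x := by rw [hinv]; ring
  have hnb : ∀ w ∈ ({1, -1, s, -s, s⁻¹, -s⁻¹} : Finset ℂ), x + y ≠ w := by
    intro w hw he
    apply hx
    simp only [bad, Finset.coe_image, Set.mem_image]
    exact ⟨w, hw, by rw [← he, hxe]⟩
  have := h (x + y) hne ?_ ?_ ?_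
  · rwa [hxe] at this
  · intro h2
    rcases (sq_eq_sq_iff_eq_or_eq_neg.mp (h2.trans (one_pow 2).symm)) with h3 | h3
    · exact hnb 1 (by simp) h3
    · exact hnb (-1) (by simp) h3
  · intro h2
    rcases (sq_eq_sq_iff_eq_or_eq_neg.mp (h2.trans (one_pow 2).symm)) with h3 | h3
    · exact hnb s⁻¹ (by simp) (by field_simp; linear_combination h3)
    · exact hnb (-s⁻¹) (by simp) (by field_simp; linear_combination h3)
  · intro h2
    rcases (sq_eq_sq_iff_eq_or_eq_neg.mp (h2.trans (one_pow 2).symm)) with h3 | h3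
    · exact hnb s (by simp) (by field_simp at h3; exact h3)
    · exact hnb (-s) (by simp) (by field_simp at h3; exact h3)

lemma aux_qh (q : ℝ) (hq0 : 0 < q) (hq1 : q < 1) : qh q ≠ 0 ∧ qh q - (qh q)⁻¹ ≠ 0 := by
  have h1 : 0 < Real.sqrt q := Real.sqrt_pos.mpr hq0
  have h2 : Real.sqrt q < 1 := by rw [Real.sqrt_lt' one_pos]; simpa using hq1
  have h0 : qh q ≠ 0 := by unfold qh; exact_mod_cast h1.ne'
  refine ⟨h0, fun h => ?_⟩
  have h3 : qh q * qh q = 1 := by field_simp at h; linear_combination h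
  have h4 : Real.sqrt q * Real.sqrt q = 1 := by unfold qh at h3; exact_mod_cast h3
  nlinarith

/-- Pointwise formula for `𝒟_q 𝒮_q`. -/
lemma aux_T (q : ℝ) (hq0 : 0 < q) (hq1 : q < 1)
    (Dq Sq : ℂ[X] → ℂ[X]) (hD : IsAW q Dq) (hS : IsAv q Sq) (p : ℂ[X]) (w : ℂ)
    (hw : w ≠ 0) (hw1 : w ^ 2 ≠ 1) (hw2 : (qh q * w) ^ 2 ≠ 1) (hw3 : ((qh q)⁻¹ * w) ^ 2 ≠ 1) :
    (Dq (Sq p)).eval ((w + w⁻¹) / 2) * ((qh q - (qh q)⁻¹) * (w - w⁻¹)) =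
      p.eval (((qh q) ^ 2 * w + ((qh q) ^ 2 * w)⁻¹) / 2) -
      p.eval ((((qh q) ^ 2)⁻¹ * w + (qh q) ^ 2 * w⁻¹) / 2) := by
  obtain ⟨hs, hs1⟩ := aux_qh q hq0 hq1
  have hww : w - w⁻¹ ≠ 0 := by
    intro h; apply hw1; field_simp at h; linear_combination h
  have e1 := hS p (qh q * w) (mul_ne_zero hs hw) hw2
  have e2 := hS p ((qh q)⁻¹ * w) (mul_ne_zero (inv_ne_zero hs) hw) hw3
  have e0 := hD (Sq p) w hw hw1
  set s := qh q
  have a1 : (s * w)⁻¹ = s⁻¹ * w⁻¹ := mul_inv _ _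
  have a2 : (s⁻¹ * w)⁻¹ = s * w⁻¹ := by rw [mul_inv, inv_inv]
  have b1 : s * (s * w) = s ^ 2 * w := by ring
  have b2 : s⁻¹ * (s⁻¹ * w⁻¹) = (s ^ 2 * w)⁻¹ := by rw [mul_inv]; ring
  have b3 : s⁻¹ * (s * w) = w := by field_simp
  have b4 : s * (s⁻¹ * w⁻¹) = w⁻¹ := by field_simp
  have b5 : s * (s⁻¹ * w) = w := by field_simp
  have b6 : s⁻¹ * (s * w⁻¹) = w⁻¹ := by field_simp
  have b7 : s⁻¹ * (s⁻¹ * w) = (s ^ 2)⁻¹ * w := by ring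
  have b8 : s * (s * w⁻¹) = s ^ 2 * w⁻¹ := by ring
  rw [a1, b1, b2, b3, b4] at e1
  rw [a2, b5, b6, b7, b8] at e2
  rw [e0, e1, e2, div_mul_eq_mul_div, div_eq_iff (mul_ne_zero (div_ne_zero hs1 two_ne_zero) hww)]
  ring

/-- The key polynomial identity. -/
lemma aux_key (q : ℝ) (hq0 : 0 < q) (hq1 : q < 1)
    (Dq Sq : ℂ[X] → ℂ[X]) (hD : IsAW q Dq) (hS : IsAv q Sq)
    (a : ℂ) (ha : a = 2 * (alp q) ^ 2 - 1)
    (p0 p1 p2 p3 p4 : ℂ[X]) (b0 b1 b2 c0 c1 c2 : ℂ)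
    (h2 : p2 = (X - C b0) * p1 - C c0 * p0)
    (h3 : p3 = (X - C b1) * p2 - C c1 * p1)
    (h4 : p4 = (X - C b2) * p3 - C c2 * p2) :
    Dq (Sq p4) - C (2 * a) * (X * Dq (Sq p3)) + C (b1 + b2) * Dq (Sq p3)
      + X * (X * Dq (Sq p2)) - C (2 * a * b1) * (X * Dq (Sq p2))
      + C (c2 + c1 + b1 ^ 2 + a ^ 2 - 1) * Dq (Sq p2)
      - C (2 * a * c1) * (X * Dq (Sq p1)) + C (c1 * (b1 + b0)) * Dq (Sq p1)
      + C (c1 * c0) * Dq (Sq p0) = 0 := by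
  obtain ⟨hs, hs1⟩ := aux_qh q hq0 hq1
  apply aux_good (qh q) hs
  intro w hw hw1 hw2 hw3
  have hww : w - w⁻¹ ≠ 0 := by
    intro h; apply hw1; field_simp at h; linear_combination h
  have T := fun p => aux_T q hq0 hq1 Dq Sq hD hS p w hw hw1 hw2 hw3
  have hk : (qh q - (qh q)⁻¹) * (w - w⁻¹) ≠ 0 := mul_ne_zero hs1 hww
  set k := (qh q - (qh q)⁻¹) * (w - w⁻¹)
  set x := (w + w⁻¹) / 2 with hx
  have cu1 : (((qh q) ^ 2 * w + ((qh q) ^ 2 * w)⁻¹) / 2) ^ 2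
      - 2 * a * x * (((qh q) ^ 2 * w + ((qh q) ^ 2 * w)⁻¹) / 2) + x ^ 2 + a ^ 2 - 1 = 0 := by
    rw [ha, hx]; unfold alp; field_simp; ring
  have cu2 : ((((qh q) ^ 2)⁻¹ * w + (qh q) ^ 2 * w⁻¹) / 2) ^ 2
      - 2 * a * x * ((((qh q) ^ 2)⁻¹ * w + (qh q) ^ 2 * w⁻¹) / 2) + x ^ 2 + a ^ 2 - 1 = 0 := by
    rw [ha, hx]; unfold alp; field_simp; ring
  set y := ((qh q) ^ 2 * w + ((qh q) ^ 2 * w)⁻¹) / 2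
  set z := (((qh q) ^ 2)⁻¹ * w + (qh q) ^ 2 * w⁻¹) / 2
  have cur : ∀ y : ℂ, y ^ 2 - 2 * a * x * y + x ^ 2 + a ^ 2 - 1 = 0 →
      p4.eval y - 2 * a * x * p3.eval y + (b1 + b2) * p3.eval y + x ^ 2 * p2.eval y
      - 2 * a * b1 * x * p2.eval y + (c2 + c1 + b1 ^ 2 + a ^ 2 - 1) * p2.eval y
      - 2 * a * c1 * x * p1.eval y + c1 * (b1 + b0) * p1.eval y + c1 * c0 * p0.eval y = 0 := by
    intro y hy
    have g2 := congrArg (eval y) h2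
    have g3 := congrArg (eval y) h3
    have g4 := congrArg (eval y) h4
    simp only [eval_sub, eval_mul, eval_X, eval_C] at g2 g3 g4
    linear_combination g4 + (y + b1 - 2 * a * x) * g3 + c1 * g2 + p2.eval y * hy
  have r1 := cur y cu1
  have r2 := cur z cu2
  apply mul_right_cancel₀ hk
  simp only [eval_sub, eval_add, eval_mul, eval_X, eval_C]
  linear_combination r1 - r2 + T p4 + (b1 + b2 - 2 * a * x) * T p3
    + (x ^ 2 - 2 * a * b1 * x + (c2 + c1 + b1 ^ 2 + a ^ 2 - 1)) * T p2
    + (c1 * (b1 + b0) - 2 * a * c1 * x) * T p1 + c1 * c0 * T p0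

lemma aux_indep (P : ℕ → ℂ[X]) (hm : ∀ n, (P n).coeff n = 1)
    (hd : ∀ n m, n < m → (P n).coeff m = 0) (k : ℕ) (d0 d1 d2 d3 d4 : ℂ)
    (h : C d4 * P (k + 4) + C d3 * P (k + 3) + C d2 * P (k + 2) + C d1 * P (k + 1)
      + C d0 * P k = 0) : d0 = 0 := by
  have key := fun j => congrArg (fun p => coeff p j) h
  simp only [coeff_add, coeff_C_mul, coeff_zero] at key
  have e4 : d4 = 0 := by
    have := key (k + 4)
    rw [hm, hd (k+3) (k+4) (by omega), hd (k+2) (k+4) (by omega), hd (k+1) (k+4) (by omega),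
      hd k (k+4) (by omega)] at this
    linear_combination this
  subst e4
  have e3 : d3 = 0 := by
    have := key (k + 3)
    rw [hm, hd (k+2) (k+3) (by omega), hd (k+1) (k+3) (by omega), hd k (k+3) (by omega)] at this
    linear_combination this
  subst e3
  have e2 : d2 = 0 := by
    have := key (k + 2)
    rw [hm, hd (k+1) (k+2) (by omega), hd k (k+2) (by omega)] at this
    linear_combination this
  subst e2
  have e1 : d1 = 0 := by
    have := key (k + 1)
    rw [hm, hd k (k+1) (by omega)] at this
    linear_combination this
  subst e1
  have := key k
  rw [hm] at this
  linear_combination this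

/-- for a monic OPS with `𝒟_q(𝒮_q P_n) = r_n P_{n-1}`, setting
`t_n = r_n/C_n`, for all `n ≥ 1`:
`r_{n+2} − 2(2α²−1)r_{n+1} + r_n = 0` and `t_{n+2} − 2(2α²−1)t_{n+1} + t_n = 0`. -/
theorem stmt_15 (q : ℝ) (hq0 : 0 < q) (hq1 : q < 1)
    (Dq Sq : ℂ[X] → ℂ[X]) (hD : IsAW q Dq) (hS : IsAv q Sq)
    (P : ℕ → ℂ[X]) (B Co : ℕ → ℂ) (hops : MonicOPS P B Co)
    (r : ℕ → ℂ) (hAp : AppellDS Dq Sq P r)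
    (t : ℕ → ℂ) (ht : ∀ n : ℕ, 1 ≤ n → t n = r n / Co n) :
    ∀ n : ℕ, 1 ≤ n →
      r (n + 2) - 2 * (2 * (alp q) ^ 2 - 1) * r (n + 1) + r n = 0 ∧
      t (n + 2) - 2 * (2 * (alp q) ^ 2 - 1) * t (n + 1) + t n = 0 := by
  have hm : ∀ n, (P n).coeff n = 1 := by
    intro n
    have := hops.monic n
    rwa [Monic, leadingCoeff, hops.deg] at this
  have hd : ∀ n m, n < m → (P n).coeff m = 0 := by
    intro n m h
    exact coeff_eq_zero_of_natDegree_lt (by rw [hops.deg]; exact h)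
  obtain ⟨hA0, hA⟩ := hAp
  have hT0 : Dq (Sq 0) = 0 := by
    obtain ⟨hs, hs1⟩ := aux_qh q hq0 hq1
    apply aux_good (qh q) hs
    intro w hw hw1 hw2 hw3
    have hww : w - w⁻¹ ≠ 0 := by
      intro h; apply hw1; field_simp at h; linear_combination h
    have T := aux_T q hq0 hq1 Dq Sq hD hS 0 w hw hw1 hw2 hw3
    simp only [eval_zero, sub_zero] at T
    exact (mul_eq_zero.mp T).resolve_right (mul_ne_zero hs1 hww)
  obtain ⟨a, ha⟩ : ∃ a, a = 2 * (alp q) ^ 2 - 1 := ⟨_, rfl⟩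
  rw [← ha]
  have hr : ∀ n : ℕ, r (n + 3) - 2 * a * r (n + 2) + r (n + 1) = 0 := by
    intro n
    obtain ⟨p0, b0, c0, p1, hp1, h2, hq0c, hq1c⟩ : ∃ (p0 : ℂ[X]) (b0 c0 : ℂ) (p1 : ℂ[X]),
        p1 = P n ∧ P (n + 1) = (X - C b0) * p1 - C c0 * p0 ∧
        (Dq (Sq p0)).coeff (n + 2) = 0 ∧
        (∀ j, n + 1 ≤ j → (Dq (Sq p1)).coeff j = 0) := by
      rcases n with _ | n
      · refine ⟨0, B 0, 0, P 0, rfl, ?_, ?_, ?_⟩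
        · rw [hops.p1, hops.p0]; simp
        · rw [hT0]; simp
        · intro j _; rw [hA0]; simp
      · refine ⟨P n, B (n + 1), Co (n + 1), P (n + 1), rfl, hops.ttrr n, ?_, ?_⟩
        · rcases n with _ | n
          · rw [hA0]; simp
          · rw [hA, coeff_C_mul, hd _ _ (by omega), mul_zero]
        · intro j hj
          rw [hA, coeff_C_mul, hd _ _ (by omega), mul_zero]
    subst hp1
    have key := aux_key q hq0 hq1 Dq Sq hD hS a ha p0 (P n) (P (n+1)) (P (n+2)) (P (n+3))
      b0 (B (n+1)) (B (n+2)) c0 (Co (n+1)) (Co (n+2)) h2 (hops.ttrr n) (hops.ttrr (n+1))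
    have kc := congrArg (fun p => coeff p (n + 2)) key
    simp only [hA] at kc
    simp only [coeff_add, coeff_sub, coeff_C_mul, coeff_zero, coeff_X_mul, hq0c,
      hq1c (n+1) le_rfl, hq1c (n+2) (by omega), hm, hd (n+1) (n+2) (by omega),
      hd n (n+1) (by omega), hd n (n+2) (by omega)] at kc
    linear_combination kc
  have htt : ∀ k : ℕ, r (k+3) * Co (k+2) * Co (k+1) - 2 * a * Co (k+3) * r (k+2) * Co (k+1)
      + Co (k+3) * Co (k+2) * r (k+1) = 0 := by
    intro k
    have key := aux_key q hq0 hq1 Dq Sq hD hS a ha (P (k+1)) (P (k+2)) (P (k+3)) (P (k+4))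
      (P (k+5)) (B (k+2)) (B (k+3)) (B (k+4)) (Co (k+2)) (Co (k+3)) (Co (k+4))
      (hops.ttrr (k+1)) (hops.ttrr (k+2)) (hops.ttrr (k+3))
    simp only [hA] at key
    apply aux_indep P hm hd k _
      (r (k+3) * Co (k+2) * (B (k+2) + B (k+1)) - 2 * a * B (k+3) * r (k+3) * Co (k+2)
        - 2 * a * Co (k+3) * r (k+2) * B (k+1) + Co (k+3) * (B (k+3) + B (k+2)) * r (k+2))
      (-2 * a * r (k+4) * Co (k+3) + r (k+3) * (Co (k+3) + B (k+2) ^ 2 + Co (k+2))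
        - 2 * a * B (k+3) * r (k+3) * B (k+2)
        + (Co (k+4) + Co (k+3) + B (k+3) ^ 2 + a ^ 2 - 1) * r (k+3) - 2 * a * Co (k+3) * r (k+2))
      (-2 * a * r (k+4) * B (k+3) + (B (k+3) + B (k+4)) * r (k+4)
        + r (k+3) * (B (k+2) + B (k+3)) - 2 * a * B (k+3) * r (k+3))
      (r (k+5) - 2 * a * r (k+4) + r (k+3))
    rw [← key]
    have e2 := hops.ttrr k
    have e3 := hops.ttrr (k+1)
    have e4 := hops.ttrr (k+2)
    simp only [Nat.add_assoc, Nat.reduceAdd] at e2 e3 e4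
    rw [e4, e3, e2]
    simp only [C_add, C_sub, C_mul, C_pow, C_neg, C_1]
    ring
  intro n hn
  obtain ⟨k, rfl⟩ : ∃ k, n = k + 1 := ⟨n - 1, by omega⟩
  refine ⟨hr k, ?_⟩
  have n1 := hops.Cne (k + 1) (by omega)
  have n2 := hops.Cne (k + 2) (by omega)
  have n3 := hops.Cne (k + 3) (by omega)
  have := htt k
  rw [ht _ (by omega), ht _ (by omega), ht _ (by omega)]
  simp only [Nat.add_assoc, Nat.reduceAdd]
  field_simp
  linear_combination this
end
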